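/- arXiv:1101.5901 — 2 statements merged into one kernel-verified Lean document; each statement's English description precedes it below -/
import Mathlib

section
/- Let n ≥ 2, let A = Mat_{n×n}(ℂ), and let r(v;y₁,y₂) be a unitary solution of the AYBE. Then r also satisfies the dual equation: r^{23}(u+v;y₂,y₃)·r^{12}(u;y₁,y₂) = r^{12}(−v;y₁,y₂)·r^{13}(u+v;y₁,y₃) + r^{13}(u;y₁,y₃)·r^{23}(v;y₂,y₃), whenever u, v, u+v are nonzero and y₁,y₂,y₃ are pairwise distinct. -/
open Matrix Kronecker Filter Topology Set

noncomputable section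

attribute [local instance] Matrix.normedAddCommGroup Matrix.normedSpace

abbrev Mat (n : ℕ) : Type := Matrix (Fin n) (Fin n) ℂ
abbrev T2 (n : ℕ) : Type := Matrix (Fin n × Fin n) (Fin n × Fin n) ℂ
abbrev T3 (n : ℕ) : Type := Matrix (Fin n × Fin n × Fin n) (Fin n × Fin n × Fin n) ℂ

/-- The embedding `t ↦ t^{12}` of `A ⊗ A` into `A ⊗ A ⊗ A`. -/
def emb12 {n : ℕ} (t : T2 n) : T3 n :=
  Matrix.of fun p q => t (p.1, p.2.1) (q.1, q.2.1) * (if p.2.2 = q.2.2 then 1 else 0)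

/-- The embedding `t ↦ t^{13}` of `A ⊗ A` into `A ⊗ A ⊗ A`. -/
def emb13 {n : ℕ} (t : T2 n) : T3 n :=
  Matrix.of fun p q => t (p.1, p.2.2) (q.1, q.2.2) * (if p.2.1 = q.2.1 then 1 else 0)

/-- The embedding `t ↦ t^{23}` of `A ⊗ A` into `A ⊗ A ⊗ A`. -/
def emb23 {n : ℕ} (t : T2 n) : T3 n :=
  Matrix.of fun p q => t (p.2.1, p.2.2) (q.2.1, q.2.2) * (if p.1 = q.1 then 1 else 0)

/-- The flip `t ↦ t^{21}` on `A ⊗ A`. -/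
def tflip {n : ℕ} (t : T2 n) : T2 n :=
  Matrix.of fun p q => t (p.2, p.1) (q.2, q.1)

/-- The associative Yang–Baxter equation with three spectral parameters. -/
def IsAYBESolution {n : ℕ} (r : ℂ → ℂ → ℂ → T2 n) : Prop :=
  ∀ u v y₁ y₂ y₃ : ℂ, u ≠ 0 → v ≠ 0 → u + v ≠ 0 → y₁ ≠ y₂ → y₁ ≠ y₃ → y₂ ≠ y₃ →
    emb12 (r u y₁ y₂) * emb23 (r (u + v) y₂ y₃) =
      emb13 (r (u + v) y₁ y₃) * emb12 (r (-v) y₁ y₂) + emb23 (r v y₂ y₃) * emb13 (r u y₁ y₃)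

/-- Unitarity: `r^{21}(-v; y₂, y₁) = - r(v; y₁, y₂)`. -/
def IsUnitarySolution {n : ℕ} (r : ℂ → ℂ → ℂ → T2 n) : Prop :=
  ∀ v y₁ y₂ : ℂ, v ≠ 0 → y₁ ≠ y₂ → tflip (r (-v) y₂ y₁) = - r v y₁ y₂

/-- `can : A ⊗ A → End(A)`, `X ⊗ Y ↦ (Z ↦ tr(XZ)·Y)`. -/
def canMap {n : ℕ} (t : T2 n) (Z : Mat n) : Mat n :=
  Matrix.of fun k l => ∑ i, ∑ j, t (i, k) (j, l) * Z j i

/-- Non-degeneracy: on a dense subset of the domain the tensor is invertible under `can`. -/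
def IsNonDegenerate {n : ℕ} (r : ℂ → ℂ → ℂ → T2 n) : Prop :=
  {p : ℂ × ℂ × ℂ | p.1 ≠ 0 ∧ p.2.1 ≠ p.2.2} ⊆
    closure {p : ℂ × ℂ × ℂ | p.1 ≠ 0 ∧ p.2.1 ≠ p.2.2 ∧
      Function.Bijective (canMap (r p.1 p.2.1 p.2.2))}

/-- `r` is holomorphic on `{(v,y₁,y₂) : v ≠ 0, y₁ ≠ y₂}`. -/
def IsHolomorphicOnDomain {n : ℕ} (r : ℂ → ℂ → ℂ → T2 n) : Prop :=
  DifferentiableOn ℂ (fun p : ℂ × ℂ × ℂ => r p.1 p.2.1 p.2.2)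
    {p : ℂ × ℂ × ℂ | p.1 ≠ 0 ∧ p.2.1 ≠ p.2.2}

/-- `r` is of the form (*): `r(v;y₁,y₂) = v⁻¹·1⊗1 + r₀(y₁,y₂) + v·r₁(y₁,y₂) + …`,
with Taylor coefficients `rc k`. -/
def HasLaurentForm {n : ℕ} (r : ℂ → ℂ → ℂ → T2 n) (rc : ℕ → ℂ → ℂ → T2 n) : Prop :=
  ∀ y₁ y₂ : ℂ, y₁ ≠ y₂ → ∃ ε > 0, ∀ v : ℂ, v ≠ 0 → ‖v‖ < ε →
    HasSum (fun k : ℕ => v ^ k • rc k y₁ y₂) (r v y₁ y₂ - v⁻¹ • 1)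

/-- `r` is meromorphic along the diagonal. -/
def IsMeromorphicAlongDiagonal {n : ℕ} (r : ℂ → ℂ → ℂ → T2 n) : Prop :=
  ∀ u : ℂ, u ≠ 0 → ∀ y₁ : ℂ, MeromorphicAt (fun y₂ => r u y₁ y₂) y₁

/-- `pr ⊗ id` on `A ⊗ A`, where `pr X = X - (tr X / n)·1`. -/
def prLeft {n : ℕ} (t : T2 n) : T2 n :=
  Matrix.of fun p q => t p q - if p.1 = q.1 then (∑ m, t (m, p.2) (m, q.2)) / (n : ℂ) else 0

/-- `id ⊗ pr` on `A ⊗ A`. -/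
def prRight {n : ℕ} (t : T2 n) : T2 n :=
  Matrix.of fun p q => t p q - if p.2 = q.2 then (∑ m, t (p.1, m) (q.1, m)) / (n : ℂ) else 0

/-- `pr ⊗ pr` on `A ⊗ A`. -/
def prTensorPr {n : ℕ} (t : T2 n) : T2 n := prLeft (prRight t)

/-- `c` has no infinitesimal symmetries: the only traceless `a` with
`[c(y₁,y₂), a⊗1 + 1⊗a] = 0` for all `y₁ ≠ y₂` is `a = 0`. -/
def HasNoInfinitesimalSymmetry {n : ℕ} (c : ℂ → ℂ → T2 n) : Prop :=
  ∀ a : Mat n, a.trace = 0 →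
    (∀ y₁ y₂ : ℂ, y₁ ≠ y₂ →
      c y₁ y₂ * (a ⊗ₖ (1 : Mat n) + (1 : Mat n) ⊗ₖ a) =
        (a ⊗ₖ (1 : Mat n) + (1 : Mat n) ⊗ₖ a) * c y₁ y₂) → a = 0

/-- The quantum Yang–Baxter equation. -/
def SatisfiesQYBE {n : ℕ} (q : ℂ → ℂ → T2 n) : Prop :=
  ∀ y₁ y₂ y₃ : ℂ, y₁ ≠ y₂ → y₁ ≠ y₃ → y₂ ≠ y₃ →
    emb12 (q y₁ y₂) * emb13 (q y₁ y₃) * emb23 (q y₂ y₃) =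
      emb23 (q y₂ y₃) * emb13 (q y₁ y₃) * emb12 (q y₁ y₂)

/-- The permutation tensor `P = Σ e_{ij} ⊗ e_{ji}`. -/
def Pmat (n : ℕ) : T2 n :=
  ∑ i : Fin n, ∑ j : Fin n,
    Matrix.single i j (1 : ℂ) ⊗ₖ Matrix.single j i (1 : ℂ)

/-- The permutation of the three tensor positions exchanging the first and the third. -/
def rev3 (n : ℕ) : (Fin n × Fin n × Fin n) ≃ (Fin n × Fin n × Fin n) where
  toFun p := (p.2.2, p.2.1, p.1)
  invFun p := (p.2.2, p.2.1, p.1)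
  left_inv _ := rfl
  right_inv _ := rfl

theorem rev_emb12 {n : ℕ} (t : T2 n) :
    (emb12 t).submatrix (rev3 n) (rev3 n) = emb23 (tflip t) := rfl

theorem rev_emb23 {n : ℕ} (t : T2 n) :
    (emb23 t).submatrix (rev3 n) (rev3 n) = emb12 (tflip t) := rfl

theorem rev_emb13 {n : ℕ} (t : T2 n) :
    (emb13 t).submatrix (rev3 n) (rev3 n) = emb13 (tflip t) := rfl

theorem emb12_neg' {n : ℕ} (t : T2 n) : emb12 (-t) = -emb12 t := by
  ext p q; simp only [emb12, Matrix.of_apply, Matrix.neg_apply, neg_mul]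

theorem emb13_neg' {n : ℕ} (t : T2 n) : emb13 (-t) = -emb13 t := by
  ext p q; simp only [emb13, Matrix.of_apply, Matrix.neg_apply, neg_mul]

theorem emb23_neg' {n : ℕ} (t : T2 n) : emb23 (-t) = -emb23 t := by
  ext p q; simp only [emb23, Matrix.of_apply, Matrix.neg_apply, neg_mul]

/-- A unitary solution of the AYBE satisfies the dual equation
`r^{23}(u+v)·r^{12}(u) = r^{12}(−v)·r^{13}(u+v) + r^{13}(u)·r^{23}(v)`. -/
theorem dual_aybe (n : ℕ) (hn : 2 ≤ n) (r : ℂ → ℂ → ℂ → T2 n)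
    (hAYBE : IsAYBESolution r) (hUnit : IsUnitarySolution r) :
    ∀ u v y₁ y₂ y₃ : ℂ, u ≠ 0 → v ≠ 0 → u + v ≠ 0 → y₁ ≠ y₂ → y₁ ≠ y₃ → y₂ ≠ y₃ →
      emb23 (r (u + v) y₂ y₃) * emb12 (r u y₁ y₂) =
        emb12 (r (-v) y₁ y₂) * emb13 (r (u + v) y₁ y₃) + emb13 (r u y₁ y₃) * emb23 (r v y₂ y₃) := by
  intro u v y₁ y₂ y₃ hu hv huv h12 h13 h23
  have e : -(u + v) + v = -u := by ring
  have h := hAYBE (-(u + v)) v y₃ y₂ y₁ (neg_ne_zero.mpr huv) hv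
    (by rw [e]; exact neg_ne_zero.mpr hu) h23.symm h13.symm h12.symm
  rw [e] at h
  have h' := congrArg (fun M : T3 n => M.submatrix (rev3 n) (rev3 n)) h
  have a1 := hUnit (-v) y₁ y₂ (neg_ne_zero.mpr hv) h12
  rw [neg_neg] at a1
  simp only [Matrix.submatrix_add, Pi.add_apply, ← Matrix.submatrix_mul_equiv _ _ _ (rev3 n) _,
    rev_emb12, rev_emb13, rev_emb23, a1, hUnit (u + v) y₂ y₃ huv h23, hUnit u y₁ y₂ hu h12,
    hUnit u y₁ y₃ hu h13, hUnit (u + v) y₁ y₃ huv h13, hUnit v y₂ y₃ hv h23,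
    emb12_neg', emb13_neg', emb23_neg', neg_mul_neg] at h'
  rw [h', add_comm]
end
end

section
/- Let n ≥ 2, let A = Mat_{n×n}(ℂ), and let r(u;y₁,y₂) be a non-degenerate unitary solution of the AYBE, holomorphic on {(u,y₁,y₂) : u ≠ 0, y₁ ≠ y₂} and meromorphic along the diagonal. Assume that for every u ≠ 0 and every y₁ the function y₂ ↦ r(u;y₁,y₂) has a pole at y₂ = y₁. Then this pole is simple and there exists a constant c ∈ ℂ, independent of u and y₁, such that lim_{y₂→y₁} (y₁−y₂)·r(u;y₁,y₂) = c·P. -/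
open Matrix Kronecker Filter Topology Set

noncomputable section

attribute [local instance] Matrix.normedAddCommGroup Matrix.normedSpace

open Filter Topology Set

section A1
variable {E : Type*} [NormedAddCommGroup E] [NormedSpace ℂ E] [CompleteSpace E]

theorem a1_param (F : ℂ → ℝ → E) (hc : Continuous (Function.uncurry F))
    (hd : ∀ θ, Differentiable ℂ (fun y => F y θ)) (a b : ℝ) :
    Differentiable ℂ (fun y => ∫ θ in a..b, F y θ) := by
  intro y0
  have hcomp : IsCompact (Metric.closedBall y0 2 ×ˢ uIcc a b) :=
    (isCompact_closedBall y0 2).prod isCompact_uIcc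
  obtain ⟨B, hB⟩ := hcomp.exists_bound_of_continuousOn hc.continuousOn
  have hcy : ∀ y, Continuous (fun θ => F y θ) := fun y => hc.comp (Continuous.prodMk_right y)
  have key := intervalIntegral.hasDerivAt_integral_of_dominated_loc_of_deriv_le (μ := MeasureTheory.volume)
    (F := F) (F' := fun y θ => deriv (fun y => F y θ) y) (x₀ := y0) (s := Metric.ball y0 1)
    (bound := fun _ => B) (a := a) (b := b)
    (Metric.ball_mem_nhds y0 one_pos)
    (Eventually.of_forall fun y => (hcy y).aestronglyMeasurable)
    ((hcy y0).intervalIntegrable _ _) ?_ ?_ ?_ ?_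
  · exact key.2.differentiableAt
  · have hlim : ∀ θ, Tendsto (fun n : ℕ => ((1:ℂ)/((n:ℂ)+1))⁻¹ • (F (y0 + 1/((n:ℂ)+1)) θ - F y0 θ)) atTop
        (𝓝 (deriv (fun y => F y θ) y0)) := by
      intro θ
      have h1 := (hd θ y0).hasDerivAt.tendsto_slope_zero
      refine h1.comp ?_
      refine tendsto_nhdsWithin_iff.2 ⟨tendsto_one_div_add_atTop_nhds_zero_nat, ?_⟩
      refine Eventually.of_forall fun n => ?_
      have : ((n:ℂ)+1) ≠ 0 := by exact_mod_cast Nat.succ_ne_zero n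
      simp [this]
    refine aestronglyMeasurable_of_tendsto_ae atTop (f := fun (n:ℕ) θ => ((1:ℂ)/((n:ℂ)+1))⁻¹ • (F (y0 + 1/((n:ℂ)+1)) θ - F y0 θ)) ?_ (Eventually.of_forall hlim)
    intro n
    exact (((hcy _).sub (hcy _)).const_smul _).aestronglyMeasurable
  · refine Eventually.of_forall fun θ hθ y hy => ?_
    have := Complex.norm_deriv_le_of_forall_mem_sphere_norm_le (f := fun y => F y θ) (c := y) (R := 1) (C := B) one_pos
      (hd θ).diffContOnCl ?_
    · simpa using this
    · intro z hz
      refine hB (z, θ) ⟨?_, uIoc_subset_uIcc hθ⟩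
      simp only [Metric.mem_sphere, Metric.mem_ball, Metric.mem_closedBall] at *
      linarith [dist_triangle z y y0]
  · exact intervalIntegrable_const
  · exact Eventually.of_forall fun θ hθ y hy => (hd θ y).hasDerivAt

/-- coefficient functions are entire -/
theorem a1_coeff (g : ℂ → ℂ → E)
    (hg : DifferentiableOn ℂ (Function.uncurry g) {p | p.2 ≠ 0}) (k : ℕ) :
    Differentiable ℂ (fun y => ∮ s in C(0,1), s^k • g y s) := by
  unfold circleIntegral
  have ho : IsOpen {p : ℂ × ℂ | p.2 ≠ 0} := isOpen_ne.preimage continuous_snd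
  have hne : ∀ θ : ℝ, circleMap 0 1 θ ≠ 0 := fun θ => by simp
  refine a1_param (fun y θ => deriv (circleMap 0 1) θ • (fun s => s^k • g y s) (circleMap 0 1 θ)) ?_ ?_ 0 (2*Real.pi)
  · have h1 : Continuous (fun p : ℂ × ℝ => g p.1 (circleMap 0 1 p.2)) := by
      have := hg.continuousOn.comp_continuous (f := fun p : ℂ × ℝ => (p.1, circleMap 0 1 p.2)) (by fun_prop) (fun p => hne p.2)
      exact this
    have h2 : Continuous (fun p : ℂ × ℝ => circleMap 0 1 p.2) := by fun_prop
    simp only [Function.uncurry_def, deriv_circleMap]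
    exact (h2.mul continuous_const).smul ((h2.pow k).smul h1)
  · intro θ
    have h1 : Differentiable ℂ (fun y => g y (circleMap 0 1 θ)) := by
      intro y
      have := (hg.differentiableAt (ho.mem_nhds (x := (y, circleMap 0 1 θ)) (hne θ))).comp y
        (f := fun y => (y, circleMap 0 1 θ)) (by fun_prop)
      exact this
    exact (h1.const_smul _).const_smul _
end A1

open Filter Topology Set

section A2
variable {E : Type*} [NormedAddCommGroup E] [NormedSpace ℂ E] [CompleteSpace E]

theorem a2_ext (h : ℂ → E) (hd : ∀ t, t ≠ 0 → DifferentiableAt ℂ h t)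
    (B : ℝ) (hb : ∀ᶠ t in 𝓝[≠] (0:ℂ), ‖h t‖ ≤ B) :
    ∃ φ : ℂ → E, Differentiable ℂ φ ∧ ∀ t, t ≠ 0 → φ t = h t := by
  obtain ⟨s, hs, hsb⟩ : ∃ s ∈ 𝓝 (0:ℂ), ∀ t ∈ s \ {0}, ‖h t‖ ≤ B := by
    rw [eventually_nhdsWithin_iff] at hb
    exact ⟨_, hb, fun t ht => ht.1 ht.2⟩
  have := Complex.differentiableOn_update_limUnder_of_bddAbove (f := h) hs
    (fun t ht => (hd t ht.2).differentiableWithinAt) ⟨B, by rintro _ ⟨t, ht, rfl⟩; exact hsb t ht⟩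
  refine ⟨Function.update h 0 (limUnder (𝓝[≠] 0) h), ?_, fun t ht => by simp [ht]⟩
  intro t
  by_cases ht : t = 0
  · subst ht; exact this.differentiableAt hs
  · refine (hd t ht).congr_of_eventuallyEq ?_
    filter_upwards [isOpen_ne.mem_nhds ht] with x hx
    simp [show x ≠ 0 from hx]

theorem a2_sect2 (g : ℂ → ℂ → E)
    (hg : DifferentiableOn ℂ (Function.uncurry g) {p | p.2 ≠ 0}) (y t : ℂ) (ht : t ≠ 0) :
    DifferentiableAt ℂ (g y) t := by
  have ho : IsOpen {p : ℂ × ℂ | p.2 ≠ 0} := isOpen_ne.preimage continuous_snd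
  exact (hg.differentiableAt (ho.mem_nhds (x := (y, t)) ht)).comp t
        (f := fun t => (y, t)) (by fun_prop)

theorem a2_sect1 (g : ℂ → ℂ → E)
    (hg : DifferentiableOn ℂ (Function.uncurry g) {p | p.2 ≠ 0}) (y t : ℂ) (ht : t ≠ 0) :
    DifferentiableAt ℂ (fun y => g y t) y := by
  have ho : IsOpen {p : ℂ × ℂ | p.2 ≠ 0} := isOpen_ne.preimage continuous_snd
  exact (hg.differentiableAt (ho.mem_nhds (x := (y, t)) ht)).comp y
        (f := fun y => (y, t)) (by fun_prop)

/-- entire extension of `t^N • g t` -/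
def AExt (g : ℂ → E) (N : ℕ) : Prop :=
  ∃ φ : ℂ → E, Differentiable ℂ φ ∧ ∀ t, t ≠ 0 → φ t = t ^ N • g t

theorem a2_diff (φ : ℂ → E) (hφ : Differentiable ℂ φ) : Differentiable ℂ (dslope φ 0) := by
  rw [← differentiableOn_univ] at *
  exact (Complex.differentiableOn_dslope (by simp)).2 hφ

theorem a2_down (g : ℂ → E) (M : ℕ) (φ : ℂ → E) (hφ : Differentiable ℂ φ)
    (h : ∀ t, t ≠ 0 → φ t = t ^ (M+1) • g t) (h0 : φ 0 = 0) : AExt g M := by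
  refine ⟨dslope φ 0, a2_diff φ hφ, fun t ht => ?_⟩
  rw [dslope_of_ne _ ht, slope_def_module, h0, h t ht, sub_zero, sub_zero, smul_smul, pow_succ']
  congr 1
  field_simp

theorem a2_cauchy (g : ℂ → E) (M : ℕ) (φ : ℂ → E) (hφ : Differentiable ℂ φ)
    (h : ∀ t, t ≠ 0 → φ t = t ^ (M+1) • g t) :
    (∮ s in C(0,1), s^M • g s) = (2 * Real.pi * Complex.I : ℂ) • φ 0 := by
  have := (hφ.differentiableOn (s := Metric.closedBall 0 1)).circleIntegral_sub_inv_smul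
    (c := 0) (R := 1) (w := 0) (by simp)
  rw [← this]
  refine circleIntegral.integral_congr zero_le_one ?_
  intro s hs
  have hs0 : s ≠ 0 := by
    rintro rfl; simp at hs
  simp only [sub_zero]
  rw [h s hs0, smul_smul, pow_succ']
  congr 1
  field_simp

theorem a2_vanish (g : ℂ → E) (N k : ℕ) (hk : N ≤ k) (h : AExt g N) :
    (∮ s in C(0,1), s^k • g s) = 0 := by
  obtain ⟨φ, hφ, h⟩ := h
  rw [a2_cauchy g k (fun t => t^(k+1-N) • φ t) (by fun_prop) ?_]
  · have : k + 1 - N ≠ 0 := by omega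
    simp [this]
  · intro t ht
    rw [h t ht, smul_smul, ← pow_add]
    congr 2; omega

theorem a2_mero (g : ℂ → E) (hg : ∀ t, t ≠ 0 → DifferentiableAt ℂ g t) (hm : MeromorphicAt g 0) :
    ∃ N, AExt g N := by
  obtain ⟨N, hN⟩ := hm
  refine ⟨N, ?_⟩
  have hc := hN.continuousAt.norm
  have hb : ∀ᶠ t in 𝓝[≠] (0:ℂ), ‖t^N • g t‖ ≤ ‖((0:ℂ)-0)^N • g 0‖ + 1 := by
    refine (hc.eventually_le_const (lt_add_one _)).filter_mono nhdsWithin_le_nhds |>.mono ?_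
    intro t ht
    simpa using ht
  exact a2_ext _ (fun t ht => by have := hg t ht; fun_prop) _ hb

theorem a2_unif (g : ℂ → ℂ → E)
    (hg : DifferentiableOn ℂ (Function.uncurry g) {p | p.2 ≠ 0})
    (hm : ∀ y, MeromorphicAt (g y) 0) : ∃ N, ∀ y, AExt (g y) N := by
  let S : ℕ → Set ℂ := fun N => ⋂ t : ℂ, ⋂ (_ : t ≠ 0), ⋂ (_ : ‖t‖ ≤ 1), {y | ‖t^N • g y t‖ ≤ N}
  have hScl : ∀ N, IsClosed (S N) := by
    intro N
    refine isClosed_iInter fun t => isClosed_iInter fun ht => isClosed_iInter fun ht1 => ?_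
    have : Continuous (fun y => g y t) :=
      continuous_iff_continuousAt.2 fun y => (a2_sect1 g hg y t ht).continuousAt
    exact isClosed_le (by fun_prop) continuous_const
  have hSU : ⋃ N, S N = univ := by
    refine eq_univ_of_forall fun y => ?_
    obtain ⟨m, φ, hφ, h⟩ := a2_mero (g y) (fun t ht => a2_sect2 g hg y t ht) (hm y)
    obtain ⟨B, hB⟩ := (isCompact_closedBall (0:ℂ) 1).exists_bound_of_continuousOn hφ.continuous.continuousOn
    obtain ⟨K, hK⟩ := exists_nat_ge B
    refine mem_iUnion.2 ⟨max m K, ?_⟩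
    simp only [S, mem_iInter, mem_ofPred_eq]
    intro t ht ht1
    have e : t ^ (max m K) • g y t = t^(max m K - m) • φ t := by
      rw [h t ht, smul_smul, ← pow_add]
      congr 2; have := le_max_left m K; omega
    rw [e, norm_smul, norm_pow]
    have h1 : ‖t‖^(max m K - m) ≤ 1 := pow_le_one₀ (norm_nonneg _) ht1
    have h2 := hB t (by simpa using ht1)
    have h3 : (K:ℝ) ≤ ((max m K : ℕ) : ℝ) := by exact_mod_cast le_max_right m K
    calc _ ≤ 1 * ‖φ t‖ := by gcongr
      _ ≤ _ := by linarith
  obtain ⟨N, z0, hz0⟩ := nonempty_interior_of_iUnion_of_closed hScl hSU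
  have hloc : ∀ y ∈ S N, AExt (g y) N := by
    intro y hy
    refine a2_ext _ (fun t ht => by have := a2_sect2 g hg y t ht; fun_prop) N ?_
    rw [eventually_nhdsWithin_iff]
    filter_upwards [Metric.closedBall_mem_nhds (0:ℂ) one_pos] with t ht1 ht
    simp only [S, mem_iInter, mem_ofPred_eq] at hy
    exact hy t ht (by simpa using ht1)
  have hzero : ∀ k, N ≤ k → ∀ y, (∮ s in C(0,1), s^k • g y s) = 0 := by
    intro k hk
    have hd := a1_coeff g hg k
    have han : AnalyticOnNhd ℂ (fun y => ∮ s in C(0,1), s^k • g y s) univ := fun y _ => hd.analyticAt y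
    have := han.eqOn_of_preconnected_of_eventuallyEq (g := fun _ => 0) (z₀ := z0) (fun y _ => analyticAt_const)
      isPreconnected_univ (mem_univ _) ?_
    · intro y; exact this (mem_univ y)
    · filter_upwards [mem_interior_iff_mem_nhds.1 hz0] with y hy
      exact a2_vanish (g y) N k hk (hloc y hy)
  refine ⟨N, fun y => ?_⟩
  obtain ⟨m, hm'⟩ := a2_mero (g y) (fun t ht => a2_sect2 g hg y t ht) (hm y)
  have hstep : ∀ j, AExt (g y) (N + j) → AExt (g y) N := by
    intro j
    induction j with
    | zero => exact id
    | succ j ih =>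
      rintro ⟨φ, hφ, h⟩
      refine ih (a2_down (g y) (N+j) φ hφ h ?_)
      have := a2_cauchy (g y) (N+j) φ hφ h
      rw [hzero _ (by omega)] at this
      simpa [Real.pi_ne_zero] using this.symm
  refine hstep m ?_
  obtain ⟨φ, hφ, h⟩ := hm'
  refine ⟨fun t => t^N • φ t, by fun_prop, fun t ht => ?_⟩
  simp only
  rw [h t ht, smul_smul, pow_add]

theorem a2_main (g : ℂ → ℂ → E)
    (hg : DifferentiableOn ℂ (Function.uncurry g) {p | p.2 ≠ 0})
    (hm : ∀ y, MeromorphicAt (g y) 0)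
    (hp : Tendsto (fun t => ‖g 0 t‖) (𝓝[≠] 0) atTop) :
    ∃ N, 1 ≤ N ∧ ∃ F : ℂ → ℂ → E, (∀ y, Differentiable ℂ (F y)) ∧
      (∀ y t, t ≠ 0 → F y t = t^N • g y t) ∧ Continuous (Function.uncurry F) ∧
      Differentiable ℂ (fun y => F y 0) ∧ ∃ y, F y 0 ≠ 0 := by
  classical
  have hex := a2_unif g hg hm
  generalize hN : Nat.find hex = N
  have hsp : ∀ y, AExt (g y) N := hN ▸ Nat.find_spec hex
  have hmin : ∀ m < N, ¬ ∀ y, AExt (g y) m := fun m hm => Nat.find_min hex (hN ▸ hm)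
  have hN1 : 1 ≤ N := by
    by_contra hlt
    have h0 : N = 0 := by omega
    rw [h0] at hsp
    obtain ⟨φ, hφ, h⟩ := hsp 0
    have h1 : Tendsto (fun t => ‖φ t‖) (𝓝[≠] 0) (𝓝 ‖φ 0‖) :=
      hφ.continuous.norm.continuousAt.tendsto.mono_left nhdsWithin_le_nhds
    refine not_tendsto_atTop_of_tendsto_nhds h1 (hp.congr' ?_)
    filter_upwards [self_mem_nhdsWithin] with t ht
    rw [h t ht]; simp
  refine ⟨N, hN1, ?_⟩
  choose F hF hFg using hsp
  obtain ⟨M, rfl⟩ : ∃ M, N = M + 1 := ⟨N-1, by omega⟩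
  refine ⟨F, hF, hFg, ?_, ?_, ?_⟩
  · have ho : IsOpen {p : ℂ × ℂ | p.2 ≠ 0} := isOpen_ne.preimage continuous_snd
    have hcg : ∀ p : ℂ × ℂ, p.2 ≠ 0 → ContinuousAt (Function.uncurry F) p := by
      intro p hp
      have h1 : ContinuousAt (fun p : ℂ × ℂ => p.2^(M+1) • Function.uncurry g p) p := by
        have := (hg.differentiableAt (ho.mem_nhds hp)).continuousAt
        fun_prop
      refine h1.congr ?_
      filter_upwards [ho.mem_nhds hp] with q hq
      exact (hFg q.1 q.2 hq).symm
    rw [continuous_iff_continuousAt]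
    rintro ⟨y0, t0⟩
    by_cases ht0 : t0 ≠ 0
    · exact hcg _ ht0
    push Not at ht0
    subst ht0
    rw [Metric.continuousAt_iff']
    intro ε hε
    have hK : ∀ᶠ y in 𝓝 y0, ∀ s ∈ Metric.sphere (0:ℂ) 1, ‖F y s - F y0 s‖ < ε/2 := by
      refine (isCompact_sphere (0:ℂ) 1).eventually_forall_of_forall_eventually ?_
      intro s hs
      have hs0 : s ≠ 0 := by rintro rfl; simp at hs
      have h1 : ContinuousAt (fun z : ℂ × ℂ => ‖F z.1 z.2 - F y0 z.2‖) (y0, s) := by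
        have a := hcg (y0, s) hs0
        have b : ContinuousAt (fun z : ℂ × ℂ => F y0 z.2) (y0, s) :=
          (hF y0).continuous.continuousAt.comp (f := fun z : ℂ × ℂ => z.2) continuous_snd.continuousAt
        exact (a.sub b).norm
      exact h1.eventually_lt_const (by simp; positivity)
    have hK2 : ∀ᶠ t in 𝓝 (0:ℂ), ‖F y0 t - F y0 0‖ < ε/2 := by
      have : ContinuousAt (fun t => ‖F y0 t - F y0 0‖) 0 := by
        have := (hF y0).continuous; fun_prop
      exact this.eventually_lt_const (by simp; positivity)
    rw [nhds_prod_eq]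
    filter_upwards [hK.prod_mk (hK2.and (Metric.ball_mem_nhds (0:ℂ) one_pos))] with ⟨y, t⟩ ⟨h1, h2, h3⟩
    rw [dist_eq_norm]
    simp only [Function.uncurry] at *
    have h4 : ‖F y t - F y0 t‖ ≤ ε/2 := by
      refine Complex.norm_le_of_forall_mem_frontier_norm_le (f := fun t => F y t - F y0 t) (U := Metric.ball 0 1)
        Metric.isBounded_ball (((hF y).sub (hF y0)).diffContOnCl) ?_ (subset_closure h3)
      intro s hs
      rw [frontier_ball _ one_ne_zero] at hs
      exact (h1 s hs).le
    calc ‖F y t - F y0 0‖ = ‖(F y t - F y0 t) + (F y0 t - F y0 0)‖ := by congr 1; abel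
      _ ≤ _ := norm_add_le _ _
      _ < ε := by linarith
  · have h1 := a1_coeff g hg M
    have h2 : (fun y => F y 0) = fun y => (2 * Real.pi * Complex.I : ℂ)⁻¹ • ∮ s in C(0,1), s^M • g y s := by
      ext y
      rw [a2_cauchy (g y) M (F y) (hF y) (hFg y), smul_smul, inv_mul_cancel₀, one_smul]
      simp [Real.pi_ne_zero]
    rw [h2]
    exact h1.const_smul _
  · by_contra hcon
    push Not at hcon
    exact hmin M (by omega) fun y => a2_down (g y) M (F y) (hF y) (hFg y) (hcon y)
end A2

open Filter Topology Set

theorem a3_bloch (f : ℂ → ℂ) (hf : Differentiable ℂ f) (h0 : ∀ x, deriv f x ≠ 0) (M : ℝ) (hM : 0 < M) :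
    ∃ z0 : ℂ, ∃ g : ℂ → ℂ, ∀ z ∈ Metric.ball z0 M, f (g z) = z ∧ HasDerivAt g (deriv f (g z))⁻¹ z := by
  have hf' : Differentiable ℂ (deriv f) := by
    rw [← differentiableOn_univ] at *
    exact hf.deriv isOpen_univ
  have hpos : 0 < ‖deriv f 0‖ := norm_pos_iff.2 (h0 0)
  set R : ℝ := 64 * M / ‖deriv f 0‖ with hR
  have hRpos : 0 < R := by positivity
  have hR1 : R * ‖deriv f 0‖ = 64 * M := by rw [hR]; field_simp
  obtain ⟨a, ha, hamax⟩ := (isCompact_closedBall (0:ℂ) R).exists_isMaxOn ⟨0, by simp [hRpos.le]⟩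
    (f := fun z => (R - ‖z‖) * ‖deriv f z‖) (by have := hf'.continuous; fun_prop)
  set L := ‖deriv f a‖ with hL
  have hLpos : 0 < L := norm_pos_iff.2 (h0 a)
  have hmax : ∀ z, ‖z‖ ≤ R → (R - ‖z‖) * ‖deriv f z‖ ≤ (R - ‖a‖) * L := by
    intro z hz; exact hamax (by simpa using hz)
  have h1 := hmax 0 (by simp [hRpos.le])
  rw [norm_zero, sub_zero, hR1] at h1
  have haR : 0 < R - ‖a‖ := by
    by_contra hcon
    push Not at hcon
    nlinarith
  set s := (R - ‖a‖)/2 with hs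
  have hspos : 0 < s := by positivity
  have hsR : R - ‖a‖ = 2 * s := by rw [hs]; ring
  rw [hsR] at hmax h1
  have hb : ∀ z ∈ Metric.ball a s, ‖deriv f z‖ ≤ 2 * L := by
    intro z hz
    rw [Metric.mem_ball, dist_eq_norm] at hz
    have h2 : ‖z‖ ≤ ‖a‖ + ‖z - a‖ := by
      calc ‖z‖ = ‖a + (z - a)‖ := by congr 1; ring
        _ ≤ _ := norm_add_le _ _
    have h3 : s ≤ R - ‖z‖ := by linarith
    have h4 := hmax z (by linarith)
    have h5 : s * ‖deriv f z‖ ≤ s * (2 * L) := by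
      calc s * ‖deriv f z‖ ≤ (R - ‖z‖) * ‖deriv f z‖ := by gcongr
        _ ≤ _ := by linarith
    exact le_of_mul_le_mul_left h5 hspos
  have hb2 : ∀ z ∈ Metric.ball a (s/8), ‖deriv f z - deriv f a‖ ≤ L/2 := by
    intro z hz
    have hz' : z ∈ Metric.ball a s := Metric.ball_subset_ball (by linarith) hz
    have := Complex.dist_le_div_mul_dist_of_mapsTo_ball (f := deriv f) (c := a) (z := z) (R₁ := s) (R₂ := 4*L)
      hf'.differentiableOn ?_ hz'
    · rw [dist_eq_norm] at this
      refine this.trans ?_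
      rw [Metric.mem_ball] at hz
      calc 4*L/s * dist z a ≤ 4*L/s * (s/8) := by gcongr
        _ = L/2 := by field_simp; norm_num
    · intro w hw
      rw [Metric.mem_closedBall, dist_eq_norm]
      have := hb w hw
      calc _ ≤ ‖deriv f w‖ + ‖deriv f a‖ := norm_sub_le _ _
        _ ≤ _ := by linarith
  set e := ContinuousLinearEquiv.unitsEquivAut ℂ (Units.mk0 (deriv f a) (h0 a)) with he
  have hesymm : ‖(e.symm : ℂ →L[ℂ] ℂ)‖ = L⁻¹ := by
    have h1 : (e.symm : ℂ →L[ℂ] ℂ) 1 = (deriv f a)⁻¹ := by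
      show e.symm 1 = _
      rw [ContinuousLinearEquiv.symm_apply_eq]
      simp [he, h0 a]
    have h2 : (e.symm : ℂ →L[ℂ] ℂ) = ContinuousLinearMap.toSpanSingleton ℂ ((deriv f a)⁻¹) := by
      ext; simp [← h1]
    rw [h2, ContinuousLinearMap.norm_toSpanSingleton, norm_inv]
  have hann : ‖(e.symm : ℂ →L[ℂ] ℂ)‖₊⁻¹ = ⟨L, hLpos.le⟩ := by
    ext
    push_cast
    rw [hesymm, inv_inv]
    rfl
  let cc : NNReal := ⟨L/2, by positivity⟩
  have happ : ApproximatesLinearOn f (e : ℂ →L[ℂ] ℂ) (Metric.ball a (s/8)) cc := by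
    intro x hx y hy
    have := Convex.norm_image_sub_le_of_norm_hasDerivWithin_le (𝕜 := ℂ) (f := fun z => f z - z * deriv f a)
      (f' := fun z => deriv f z - deriv f a) (s := Metric.ball a (s/8)) (x := y) (y := x) (C := L/2) ?_ hb2
      (convex_ball _ _) hy hx
    · refine le_trans (le_of_eq ?_) this
      congr 1
      simp [he]
      ring
    · intro z hz
      have h1 := (hf z).hasDerivAt.sub ((hasDerivAt_id z).mul_const (deriv f a))
      rw [one_mul] at h1
      exact h1.hasDerivWithinAt
  have hcc : Subsingleton ℂ ∨ cc < ‖(e.symm : ℂ →L[ℂ] ℂ)‖₊⁻¹ := by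
    right
    rw [hann]
    show L/2 < L
    linarith
  have htgt := ApproximatesLinearOn.closedBall_subset_target (ε := s/16) happ hcc Metric.isOpen_ball (b := a)
    (by positivity) (Metric.closedBall_subset_ball (by linarith))
  set Φ := ApproximatesLinearOn.toOpenPartialHomeomorph f (Metric.ball a (s/8)) happ hcc Metric.isOpen_ball with hΦ
  refine ⟨f a, Φ.symm, ?_⟩
  intro z hz
  have hz' : z ∈ Φ.target := by
    refine htgt (Metric.closedBall_subset_closedBall ?_ (Metric.ball_subset_closedBall hz))
    rw [hann]
    show M ≤ (L - L/2) * (s/16)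
    nlinarith
  have hfe : ∀ w, Φ w = f w := fun w => rfl
  refine ⟨?_, ?_⟩
  · rw [← hfe]; exact Φ.right_inv hz'
  · exact Φ.hasDerivAt_symm hz' (h0 _) (hf _).hasDerivAt

theorem a3_inj (f : ℂ → ℂ) (hf : Differentiable ℂ f) (h0 : ∀ x, deriv f x ≠ 0)
    (hinj : Function.Injective f) (x y : ℂ) : deriv f x = deriv f y := by
  have hq : Differentiable ℂ (dslope f 0) := a2_diff f hf
  have hq0 : ∀ z, dslope f 0 z ≠ 0 := by
    intro z
    by_cases hz : z = 0
    · subst hz; rw [dslope_same]; exact h0 0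
    · rw [dslope_of_ne _ hz, slope_def_field]
      refine div_ne_zero (fun h => hz (hinj (sub_eq_zero.1 h))) (by simpa using hz)
  set G : ℂ → ℂ := fun z => (dslope f 0 z)⁻¹ with hG
  have hGd : Differentiable ℂ G := fun z => (hq z).inv (hq0 z)
  have hG0 : ∀ z, G z ≠ 0 := fun z => inv_ne_zero (hq0 z)
  have hopen : IsOpenMap f := isOpenMap_of_hasStrictDerivAt (f' := deriv f)
    (fun x => (hf.analyticAt x).hasStrictDerivAt) h0
  obtain ⟨δ, hδ, hball⟩ := Metric.mem_nhds_iff.1 (hopen.image_mem_nhds (Metric.ball_mem_nhds (0:ℂ) one_pos))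
  have hfar : ∀ z, 1 ≤ ‖z‖ → δ ≤ ‖f z - f 0‖ := by
    intro z hz
    by_contra hcon
    push Not at hcon
    obtain ⟨w, hw, hwz⟩ := hball (show f z ∈ Metric.ball (f 0) δ by rwa [Metric.mem_ball, dist_eq_norm])
    have := hinj hwz
    subst this
    simp at hw
    linarith
  have hGb : ∀ z, 1 ≤ ‖z‖ → ‖G z‖ ≤ ‖z‖ / δ := by
    intro z hz
    have hz0 : z ≠ 0 := by rintro rfl; norm_num at hz
    simp only [hG]
    rw [dslope_of_ne _ hz0, slope_def_field, norm_inv, norm_div, inv_div, sub_zero]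
    have := hfar z hz
    gcongr
  set Q := dslope G 0 with hQ
  have hQd : Differentiable ℂ Q := a2_diff G hGd
  obtain ⟨B, hB⟩ := (isCompact_closedBall (0:ℂ) 1).exists_bound_of_continuousOn hQd.continuous.continuousOn
  have hQb : Bornology.IsBounded (range Q) := by
    rw [isBounded_iff_forall_norm_le]
    refine ⟨max B (1/δ + ‖G 0‖), ?_⟩
    rintro _ ⟨z, rfl⟩
    by_cases hz : ‖z‖ ≤ 1
    · exact (hB z (by simpa using hz)).trans (le_max_left _ _)
    · push Not at hz
      have hz0 : z ≠ 0 := by rintro rfl; norm_num at hz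
      refine le_trans ?_ (le_max_right _ _)
      rw [hQ, dslope_of_ne _ hz0, slope_def_field, norm_div, sub_zero, div_le_iff₀ (by linarith)]
      calc ‖G z - G 0‖ ≤ ‖G z‖ + ‖G 0‖ := norm_sub_le _ _
        _ ≤ ‖z‖ / δ + ‖G 0‖ * ‖z‖ := by
          have := hGb z hz.le
          have := norm_nonneg (G 0)
          nlinarith
        _ = _ := by ring
  have hQc : ∀ z, Q z = Q 0 := fun z => hQd.apply_eq_apply_of_bounded hQb z 0
  have hGaff : ∀ z, G z = G 0 + z * Q 0 := by
    intro z
    have := sub_smul_dslope G 0 z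
    rw [← hQ, hQc z] at this
    simp at this
    rw [this]; ring
  have hk : Q 0 = 0 := by
    by_contra hk
    refine hG0 (-G 0 / Q 0) ?_
    rw [hGaff]; field_simp; ring
  have hGc : ∀ z, dslope f 0 z = (G 0)⁻¹ := by
    intro z
    have := hGaff z
    rw [hk, mul_zero, add_zero] at this
    rw [← this]; simp [hG]
  have hfaff : f = fun z => f 0 + z * (G 0)⁻¹ := by
    ext z
    have := sub_smul_dslope f 0 z
    rw [hGc z] at this
    simp only [sub_zero, smul_eq_mul] at this
    rw [this]; ring
  rw [hfaff]
  simp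

theorem a3_key (C : ℂ → ℂ) (hC : Differentiable ℂ C) (hC0 : ∀ x, C x ≠ 0) (H : ℂ × ℂ → ℂ)
    (hH : ∀ x y, x ≠ y → DifferentiableAt ℂ H (x, y))
    (hD : ∀ x y, x ≠ y → fderiv ℂ H (x, y) (C x, C y) = 0)
    (m : ℕ) (hm : m ≠ 0)
    (hlim : ∀ p, ∃ l : ℂ, l ≠ 0 ∧ Tendsto (fun x => ((p - x) * (x - p)) ^ m * H (x, p)) (𝓝[≠] p) (𝓝 l))
    (x y : ℂ) : C x = C y := by
  have hCi : Differentiable ℂ (fun x => (C x)⁻¹) := fun x => (hC x).inv (hC0 x)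
  obtain ⟨f, hf⟩ := hCi.isExactOn_univ
  replace hf : ∀ x, HasDerivAt f (C x)⁻¹ x := fun x => hf x (mem_univ x)
  have hfd : Differentiable ℂ f := fun x => (hf x).differentiableAt
  have hf' : ∀ x, deriv f x = (C x)⁻¹ := fun x => (hf x).deriv
  have hf0 : ∀ x, deriv f x ≠ 0 := fun x => by rw [hf' x]; exact inv_ne_zero (hC0 x)
  suffices hinj : Function.Injective f by
    have := a3_inj f hfd hf0 hinj x y
    rw [hf', hf'] at this
    exact inv_injective this
  intro p q hpq
  by_contra hne
  set Y : ℝ → ℂ := fun τ => p + τ * (q - p) with hY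
  have hYc : Continuous Y := by fun_prop
  obtain ⟨B, hB⟩ := (isCompact_Icc (a := (0:ℝ)) (b := 1)).exists_bound_of_continuousOn
    (f := fun τ => f (Y τ) - f p) (by have := hfd.continuous; fun_prop)
  set M := max B 0 + 1 with hM
  have hMpos : 0 < M := by positivity
  have hBM : ∀ τ ∈ Icc (0:ℝ) 1, ‖f (Y τ) - f p‖ < M := fun τ hτ => by
    have := hB τ hτ; have := le_max_left B 0; linarith
  obtain ⟨z0, g, hg⟩ := a3_bloch f hfd hf0 (2*M) (by positivity)
  have hfg : ∀ z ∈ Metric.ball z0 (2*M), f (g z) = z := fun z hz => (hg z hz).1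
  have hgd : ∀ z ∈ Metric.ball z0 (2*M), HasDerivAt g (C (g z)) z := fun z hz => by
    have := (hg z hz).2; rwa [hf', inv_inv] at this
  have htrans : ∀ ζ ∈ Metric.ball z0 M, ζ ≠ f p → H (g ζ, p) = H (g ζ, q) := by
    intro ζ hζ hζp
    have hin : ∀ τ ∈ Icc (0:ℝ) 1, ζ + (f (Y τ) - f p) ∈ Metric.ball z0 (2*M) := by
      intro τ hτ
      have h1 := hBM τ hτ
      rw [Metric.mem_ball, dist_eq_norm] at *
      calc ‖ζ + (f (Y τ) - f p) - z0‖ = ‖(ζ - z0) + (f (Y τ) - f p)‖ := by congr 1; ring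
        _ ≤ _ := norm_add_le _ _
        _ < _ := by linarith
    set X : ℝ → ℂ := fun τ => g (ζ + (f (Y τ) - f p)) with hX
    have hXY : ∀ τ ∈ Icc (0:ℝ) 1, X τ ≠ Y τ := by
      intro τ hτ h
      have h1 := hfg _ (hin τ hτ)
      rw [show g (ζ + (f (Y τ) - f p)) = Y τ from h] at h1
      apply hζp
      linear_combination -h1
    have hder : ∀ τ ∈ Icc (0:ℝ) 1, HasDerivAt (fun τ => H (X τ, Y τ)) 0 τ := by
      intro τ hτ
      have hYd : HasDerivAt Y (q - p) τ := by
        have h1 : HasDerivAt (fun τ : ℝ => (τ:ℂ)) 1 τ := Complex.ofRealCLM.hasDerivAt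
        have := (h1.mul_const (q - p)).const_add p
        rw [one_mul] at this
        exact this
      have hfY : HasDerivAt (fun τ => ζ + (f (Y τ) - f p)) ((C (Y τ))⁻¹ * (q - p)) τ := by
        have := (((hf (Y τ)).comp (𝕜 := ℝ) (𝕜' := ℂ) τ hYd).sub_const (f p)).const_add ζ
        exact this
      have hXd : HasDerivAt X (C (X τ) * ((C (Y τ))⁻¹ * (q - p))) τ :=
        (hgd _ (hin τ hτ)).comp (𝕜 := ℝ) (𝕜' := ℂ) τ hfY
      have hHd := ((hH _ _ (hXY τ hτ)).hasFDerivAt.restrictScalars ℝ).comp_hasDerivAt τ (hXd.prodMk hYd)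
      have e : (C (X τ) * ((C (Y τ))⁻¹ * (q - p)), q - p) = ((C (Y τ))⁻¹ * (q - p)) • (C (X τ), C (Y τ)) := by
        ext
        · simp; ring
        · have := hC0 (Y τ); simp; field_simp
      have e2 : (ContinuousLinearMap.restrictScalars ℝ (fderiv ℂ H (X τ, Y τ)))
          (C (X τ) * ((C (Y τ))⁻¹ * (q - p)), q - p) = 0 := by
        rw [e]
        show fderiv ℂ H (X τ, Y τ) _ = 0
        rw [map_smul, hD _ _ (hXY τ hτ), smul_zero]
      rw [e2] at hHd
      exact hHd
    have := constant_of_has_deriv_right_zero (f := fun τ => H (X τ, Y τ)) (a := 0) (b := 1)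
      (fun τ hτ => (hder τ hτ).continuousAt.continuousWithinAt)
      (fun τ hτ => (hder τ ⟨hτ.1, hτ.2.le⟩).hasDerivWithinAt) 1 (by simp)
    have hY0 : Y 0 = p := by simp [hY]
    have hY1 : Y 1 = q := by simp [hY]
    simp only [hX, hY0, hY1, ← hpq, sub_self, add_zero] at this
    exact this.symm
  -- a good point
  obtain ⟨ζb, hζb, hζbp⟩ : ∃ ζb ∈ Metric.ball z0 M, ζb ≠ f p := by
    by_cases h : z0 = f p
    · refine ⟨z0 + (M/2 : ℝ), ?_, ?_⟩
      · rw [Metric.mem_ball, dist_eq_norm]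
        simp [abs_of_pos hMpos]
        linarith
      · rw [← h]; simp; linarith
    · exact ⟨z0, by simp [hMpos], h⟩
  have hsub : Metric.ball z0 M ⊆ Metric.ball z0 (2*M) := Metric.ball_subset_ball (by linarith)
  have hgpq : ∀ ζ ∈ Metric.ball z0 M, ζ ≠ f p → g ζ ∈ ({p, q} : Set ℂ)ᶜ := by
    intro ζ hζ hζp hmem
    have h1 := hfg ζ (hsub hζ)
    rcases hmem with h | h
    · rw [h] at h1; exact hζp h1.symm
    · rw [mem_singleton_iff.1 h, ← hpq] at h1; exact hζp h1.symm
  have hopen : IsOpen (({p, q} : Set ℂ)ᶜ) := (Set.toFinite {p, q}).isClosed.isOpen_compl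
  have hpre : IsPreconnected (({p, q} : Set ℂ)ᶜ) :=
    ((Set.toFinite {p, q}).countable.isPathConnected_compl_of_one_lt_rank
      (by rw [Complex.rank_real_complex]; norm_num)).isConnected.isPreconnected
  have hHan : ∀ w ∈ ({p, q} : Set ℂ), AnalyticOnNhd ℂ (fun x => H (x, w)) ({p, q} : Set ℂ)ᶜ := by
    intro w hw
    refine DifferentiableOn.analyticOnNhd (fun x hx => ?_) hopen
    refine ((hH x w ?_).comp x (f := fun x => (x, w)) (by fun_prop)).differentiableWithinAt
    rintro rfl; exact hx hw
  have hfreq : ∃ᶠ x in 𝓝[≠] (g ζb), H (x, p) = H (x, q) := by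
    have ht : Tendsto g (𝓝[≠] ζb) (𝓝[≠] (g ζb)) := by
      refine tendsto_nhdsWithin_iff.2 ⟨((hgd ζb (hsub hζb)).continuousAt.tendsto).mono_left nhdsWithin_le_nhds, ?_⟩
      filter_upwards [self_mem_nhdsWithin, nhdsWithin_le_nhds (Metric.isOpen_ball.mem_nhds hζb)] with ζ h1 h2 h3
      apply h1
      have := congrArg f (mem_singleton_iff.1 h3)
      rwa [hfg ζ (hsub h2), hfg ζb (hsub hζb)] at this
    refine ht.frequently (Eventually.frequently ?_)
    filter_upwards [nhdsWithin_le_nhds (Metric.isOpen_ball.mem_nhds hζb), nhdsWithin_le_nhds (isOpen_ne.mem_nhds hζbp)] with ζ h1 h2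
    exact htrans ζ h1 h2
  have heq := (hHan p (by simp)).eqOn_of_preconnected_of_frequently_eq (hHan q (by simp)) hpre
    (hgpq ζb hζb hζbp) hfreq
  obtain ⟨l, hl, hlt⟩ := hlim p
  have hc : ContinuousAt (fun x => ((p - x) * (x - p)) ^ m * H (x, q)) p := by
    have h1 : ContinuousAt (fun x => H (x, q)) p :=
      (hH p q hne).continuousAt.comp (f := fun x => (x, q)) (by fun_prop)
    exact ContinuousAt.mul (by fun_prop) h1
  have hc' := hc.tendsto.mono_left (nhdsWithin_le_nhds (s := {p}ᶜ))
  simp only [sub_self, mul_zero, zero_pow hm, zero_mul] at hc'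
  refine hl (tendsto_nhds_unique hlt (hc'.congr' ?_))
  filter_upwards [self_mem_nhdsWithin, nhdsWithin_le_nhds (isOpen_ne.mem_nhds hne)] with x h1 h2
  have : H (x, p) = H (x, q) := heq (by simp only [mem_compl_iff, mem_insert_iff, mem_singleton_iff, not_or]; exact ⟨h1, h2⟩)
  rw [this]

theorem b1_P (n : ℕ) (p q : Fin n × Fin n) :
    Pmat n p q = if p.1 = q.2 ∧ p.2 = q.1 then 1 else 0 := by
  unfold Pmat
  simp only [Matrix.sum_apply, Matrix.kroneckerMap_apply, Matrix.single_apply]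
  rw [Finset.sum_eq_single p.1, Finset.sum_eq_single q.1]
  · by_cases h1 : p.1 = q.2 <;> by_cases h2 : p.2 = q.1 <;> simp [h1, h2, eq_comm]
    all_goals simp_all [eq_comm]
  · intro b _ hb; simp [hb]
  · simp
  · intro b _ hb; simp [hb]
  · simp

theorem b1_1223 {n : ℕ} (R T : T2 n) (p q : Fin n × Fin n × Fin n) :
    (emb12 R * emb23 T) p q = ∑ s, R (p.1, p.2.1) (q.1, s) * T (s, p.2.2) (q.2.1, q.2.2) := by
  simp only [Matrix.mul_apply, Fintype.sum_prod_type, emb12, emb23, Matrix.of_apply]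
  rw [Finset.sum_eq_single q.1]
  · refine Finset.sum_congr rfl fun s _ => ?_
    rw [Finset.sum_eq_single p.2.2] <;> simp +contextual [eq_comm]
  · intro b _ hb; simp [hb]
  · simp

theorem b1_1312 {n : ℕ} (R T : T2 n) (p q : Fin n × Fin n × Fin n) :
    (emb13 R * emb12 T) p q = ∑ s, R (p.1, p.2.2) (s, q.2.2) * T (s, p.2.1) (q.1, q.2.1) := by
  simp only [Matrix.mul_apply, Fintype.sum_prod_type, emb12, emb13, Matrix.of_apply]
  refine Finset.sum_congr rfl fun s _ => ?_
  rw [Finset.sum_eq_single p.2.1]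
  · rw [Finset.sum_eq_single q.2.2] <;> simp +contextual [eq_comm]
  · intro b _ hb; simp [hb.symm]
  · simp

theorem b1_2313 {n : ℕ} (R T : T2 n) (p q : Fin n × Fin n × Fin n) :
    (emb23 R * emb13 T) p q = ∑ s, R (p.2.1, p.2.2) (q.2.1, s) * T (p.1, s) (q.1, q.2.2) := by
  simp only [Matrix.mul_apply, Fintype.sum_prod_type, emb23, emb13, Matrix.of_apply]
  rw [Finset.sum_eq_single p.1]
  · rw [Finset.sum_eq_single q.2.1]
    · simp
    · intro b _ hb; simp [hb]
    · simp
  · intro b _ hb; simp [hb.symm]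
  · simp

/-- linear map versions -/
def e12 (n : ℕ) : T2 n →ₗ[ℂ] T3 n where
  toFun := emb12
  map_add' x y := by ext; simp only [emb12, Matrix.of_apply, Matrix.add_apply, add_mul]
  map_smul' c x := by ext; simp [emb12]
def e13 (n : ℕ) : T2 n →ₗ[ℂ] T3 n where
  toFun := emb13
  map_add' x y := by ext; simp only [emb13, Matrix.of_apply, Matrix.add_apply, add_mul]
  map_smul' c x := by ext; simp [emb13]
def e23 (n : ℕ) : T2 n →ₗ[ℂ] T3 n where
  toFun := emb23
  map_add' x y := by ext; simp only [emb23, Matrix.of_apply, Matrix.add_apply, add_mul]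
  map_smul' c x := by ext; simp [emb23]
def eflip (n : ℕ) : T2 n →ₗ[ℂ] T2 n where
  toFun := tflip
  map_add' x y := by ext; simp [tflip]
  map_smul' c x := by ext; simp [tflip]
def canLin {n : ℕ} : T2 n →ₗ[ℂ] Mat n →ₗ[ℂ] Mat n where
  toFun t :=
    { toFun := canMap t
      map_add' := fun x y => by ext; simp [canMap, mul_add, Finset.sum_add_distrib]
      map_smul' := fun c x => by ext; simp [canMap, Finset.mul_sum, mul_left_comm] }
  map_add' x y := by
    refine LinearMap.ext fun Z => ?_
    ext; simp [canMap, add_mul, Finset.sum_add_distrib]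
  map_smul' c x := by
    refine LinearMap.ext fun Z => ?_
    ext; simp [canMap, Finset.mul_sum, mul_assoc]

theorem e12_apply {n : ℕ} (t : T2 n) : e12 n t = emb12 t := rfl
theorem e13_apply {n : ℕ} (t : T2 n) : e13 n t = emb13 t := rfl
theorem e23_apply {n : ℕ} (t : T2 n) : e23 n t = emb23 t := rfl
theorem emb12_smul {n : ℕ} (c : ℂ) (t : T2 n) : emb12 (c • t) = c • emb12 t := (e12 n).map_smul c t
theorem emb13_smul {n : ℕ} (c : ℂ) (t : T2 n) : emb13 (c • t) = c • emb13 t := (e13 n).map_smul c t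
theorem emb23_smul {n : ℕ} (c : ℂ) (t : T2 n) : emb23 (c • t) = c • emb23 t := (e23 n).map_smul c t
theorem tflip_smul {n : ℕ} (c : ℂ) (t : T2 n) : tflip (c • t) = c • tflip t := (eflip n).map_smul c t
@[fun_prop]
theorem emb12_cont {n : ℕ} : Continuous (emb12 (n := n)) := (e12 n).continuous_of_finiteDimensional
@[fun_prop]
theorem emb13_cont {n : ℕ} : Continuous (emb13 (n := n)) := (e13 n).continuous_of_finiteDimensional
@[fun_prop]
theorem emb23_cont {n : ℕ} : Continuous (emb23 (n := n)) := (e23 n).continuous_of_finiteDimensional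
@[fun_prop]
theorem tflip_cont {n : ℕ} : Continuous (tflip (n := n)) := (eflip n).continuous_of_finiteDimensional

theorem b1_bij {n : ℕ} (t : T2 n) : Function.Bijective (canMap t) ↔ LinearMap.det (canLin t) ≠ 0 := by
  rw [← isUnit_iff_ne_zero, ← LinearMap.isUnit_iff_isUnit_det, Module.End.isUnit_iff]
  rfl

theorem b1_detcont {n : ℕ} : Continuous (fun t : T2 n => LinearMap.det (canLin t)) := by
  classical
  let b := Matrix.stdBasis ℂ (Fin n) (Fin n)
  have : (fun t : T2 n => LinearMap.det (canLin t)) = fun t => (LinearMap.toMatrix b b (canLin t)).det := by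
    ext t; rw [LinearMap.det_toMatrix]
  rw [this]
  have h : Continuous (fun t : T2 n => LinearMap.toMatrix b b (canLin t)) :=
    ((LinearMap.toMatrix b b).toLinearMap ∘ₗ canLin).continuous_of_finiteDimensional
  exact h.matrix_det

/-- contraction -/
theorem b1_alg {n : ℕ} (R T S : T2 n) (hR : Function.Bijective (canMap R))
    (h : emb12 R * emb23 T = emb23 S * emb13 R) :
    T = S ∧ ∀ a p1 p2 q1 q2, T (p1, p2) (q1, q2) = if p1 = q2 then T (a, p2) (q1, a) else 0 := by
  have key : ∀ X : Mat n, ∀ p2 p3 q2 q3, ∑ s, X p2 s * T (s, p3) (q2, q3) = ∑ s, S (p2, p3) (q2, s) * X s q3 := by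
    intro X p2 p3 q2 q3
    obtain ⟨Z, rfl⟩ := hR.2 X
    have h1 : ∀ i j, ∑ s, R (i, p2) (j, s) * T (s, p3) (q2, q3) = ∑ s, S (p2, p3) (q2, s) * R (i, s) (j, q3) := by
      intro i j
      have := congrFun (congrFun h (i, p2, p3)) (j, q2, q3)
      rwa [b1_1223, b1_2313] at this
    simp only [canMap, Matrix.of_apply]
    calc _ = ∑ i, ∑ j, Z j i * ∑ s, R (i, p2) (j, s) * T (s, p3) (q2, q3) := by
          simp only [Finset.sum_mul, Finset.mul_sum]
          rw [Finset.sum_comm]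
          refine Finset.sum_congr rfl fun i _ => ?_
          rw [Finset.sum_comm]
          refine Finset.sum_congr rfl fun j _ => Finset.sum_congr rfl fun s _ => by ring
      _ = ∑ i, ∑ j, Z j i * ∑ s, S (p2, p3) (q2, s) * R (i, s) (j, q3) := by simp only [h1]
      _ = _ := by
          simp only [Finset.mul_sum]
          rw [Finset.sum_comm' (t' := Finset.univ) (s' := fun _ => Finset.univ) (by simp)]
          rw [Finset.sum_comm]
          conv_rhs => rw [Finset.sum_comm]
          refine Finset.sum_congr rfl fun i _ => ?_
          conv_rhs => rw [Finset.sum_comm]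
          refine Finset.sum_congr rfl fun j _ => Finset.sum_congr rfl fun s _ => by ring
  have hTS : T = S := by
    ext ⟨p2, p3⟩ ⟨q2, q3⟩
    have := key 1 p2 p3 q2 q3
    simpa [Matrix.one_apply] using this
  refine ⟨hTS, ?_⟩
  subst hTS
  intro a p1 p2 q1 q2
  have := key (Matrix.single a p1 1) a p2 q1 q2
  simp only [Matrix.single_apply] at this
  rw [Finset.sum_eq_single p1, Finset.sum_eq_single a] at this
  · simp at this
    exact this
  · intro b _ hb; simp [hb.symm]
  · simp
  · intro b _ hb; simp [hb.symm]
  · simp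

theorem b1_form {n : ℕ} (o : Fin n) (T : T2 n) (ε : ℂ)
    (h : ∀ a p1 p2 q1 q2, T (p1, p2) (q1, q2) = if p1 = q2 then T (a, p2) (q1, a) else 0)
    (hf : tflip T = ε • T) : T = T (o, o) (o, o) • Pmat n := by
  have hf' : ∀ p1 p2 q1 q2, T (p2, p1) (q2, q1) = ε * T (p1, p2) (q1, q2) := by
    intro p1 p2 q1 q2
    have := congrFun (congrFun hf (p1, p2)) (q1, q2)
    simpa [tflip] using this
  have hz : ∀ a p q, p ≠ q → T (a, p) (q, a) = 0 := by
    intro a p q hpq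
    rw [hf' p a a q, h a p a a q]
    simp [hpq]
  have hd : ∀ a b, T (a, b) (b, a) = T (o, o) (o, o) := by
    intro a b
    have h1 : T (a, b) (b, a) = T (o, b) (b, o) := by rw [h o a b b a]; simp
    rw [h1, hf' b o o b, h o b o o b]
    simp only [if_true]
    rw [← hf' o o o o]
  ext ⟨p1, p2⟩ ⟨q1, q2⟩
  rw [Matrix.smul_apply, b1_P]
  by_cases h1 : p1 = q2
  · subst h1
    by_cases h2 : p2 = q1
    · subst h2; simp [hd]
    · simp [h2, hz p1 p2 q1 h2]
  · rw [h o]; simp [h1]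

theorem b1_lim {n : ℕ} (r : ℂ → ℂ → ℂ → T2 n) (hA : IsAYBESolution r)
    (hHolo : IsHolomorphicOnDomain r)
    (u v y₁ y₂ : ℂ) (hu : u ≠ 0) (hv : v ≠ 0) (huv : u + v ≠ 0) (hy : y₁ ≠ y₂) (K : ℕ) (hK : K ≠ 0)
    (F G : ℂ → T2 n) (hF : Continuous F) (hG : Continuous G)
    (hFr : ∀ t, t ≠ 0 → F t = t^K • r (u+v) y₂ (y₂+t))
    (hGr : ∀ t, t ≠ 0 → G t = t^K • r v y₂ (y₂+t)) :
    emb12 (r u y₁ y₂) * emb23 (F 0) = emb23 (G 0) * emb13 (r u y₁ y₂) := by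
  have hopen : IsOpen {p : ℂ × ℂ × ℂ | p.1 ≠ 0 ∧ p.2.1 ≠ p.2.2} :=
    (isOpen_ne.preimage continuous_fst).inter
      (isOpen_ne_fun (continuous_fst.comp continuous_snd) (continuous_snd.comp continuous_snd))
  have hc : ∀ w, w ≠ 0 → ContinuousAt (fun t => r w y₁ (y₂ + t)) 0 := by
    intro w hw
    have := (hHolo.differentiableAt (hopen.mem_nhds (x := (w, y₁, y₂ + 0)) ⟨hw, by simpa using hy⟩)).continuousAt.comp
      (f := fun t : ℂ => (w, y₁, y₂ + t)) (x := 0) (by fun_prop)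
    exact this
  have h1 : ContinuousAt (fun t => emb12 (r u y₁ y₂) * emb23 (F t)) 0 := by fun_prop
  have h2 : ContinuousAt (fun t => t^K • (emb13 (r (u+v) y₁ (y₂+t)) * emb12 (r (-v) y₁ y₂)) +
      emb23 (G t) * emb13 (r u y₁ (y₂ + t))) 0 := by
    have a := hc (u+v) huv
    have b := hc u hu
    have a' := (emb13_cont (n := n)).continuousAt.comp a
    have b' := (emb13_cont (n := n)).continuousAt.comp b
    have d' : ContinuousAt (fun t => emb23 (G t)) 0 := by fun_prop
    exact ContinuousAt.add ((by fun_prop : ContinuousAt (fun t : ℂ => t^K) 0).smul (a'.mul continuousAt_const))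
      (d'.mul b')
  have h3 := h1.tendsto.mono_left (nhdsWithin_le_nhds (s := {0}ᶜ))
  have h4 := h2.tendsto.mono_left (nhdsWithin_le_nhds (s := {0}ᶜ))
  have := tendsto_nhds_unique h3 (h4.congr' ?_)
  · simpa [hK] using this
  · filter_upwards [self_mem_nhdsWithin, nhdsWithin_le_nhds
      ((by fun_prop : ContinuousAt (fun t : ℂ => y₂ + t) 0).eventually_ne (y := y₁) (by simpa using hy.symm))] with t ht ht'
    have ht0 : t ≠ 0 := ht
    rw [hFr t ht0, hGr t ht0, emb23_smul, emb23_smul, Matrix.mul_smul, Matrix.smul_mul,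
      hA u v y₁ y₂ (y₂+t) hu hv huv hy ht'.symm (by simpa using ht0), smul_add]

theorem b2_ident {E : Type*} [NormedAddCommGroup E] [NormedSpace ℂ E] [CompleteSpace E] (f g : ℂ → E)
    (hf : Differentiable ℂ f) (hg : Differentiable ℂ g) (z : ℂ) (h : ∀ᶠ x in 𝓝 z, f x = g x) (x : ℂ) : f x = g x :=
  AnalyticOnNhd.eqOn_of_preconnected_of_eventuallyEq (U := univ) (fun y _ => hf.analyticAt y)
    (fun y _ => hg.analyticAt y) isPreconnected_univ (mem_univ z) h (mem_univ x)

theorem b2_open : IsOpen {p : ℂ × ℂ × ℂ | p.1 ≠ 0 ∧ p.2.1 ≠ p.2.2} :=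
    (isOpen_ne.preimage continuous_fst).inter
      (isOpen_ne_fun (continuous_fst.comp continuous_snd) (continuous_snd.comp continuous_snd))

/-- pole data -/
structure PD {n : ℕ} (r : ℂ → ℂ → ℂ → T2 n) (u : ℂ) (N : ℕ) (F : ℂ → ℂ → T2 n) : Prop where
  pos : N ≠ 0
  dif : ∀ y, Differentiable ℂ (F y)
  eq : ∀ y t, t ≠ 0 → F y t = t^N • r u y (y+t)
  cont : Continuous (Function.uncurry F)
  dif0 : Differentiable ℂ (fun y => F y 0)
  ne : ∃ y, F y 0 ≠ 0

theorem b2_exists {n : ℕ} (r : ℂ → ℂ → ℂ → T2 n)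
    (hHolo : IsHolomorphicOnDomain r) (hMero : IsMeromorphicAlongDiagonal r)
    (hPole : ∀ u : ℂ, u ≠ 0 → ∀ y₁ : ℂ,
      Filter.Tendsto (fun y₂ => ‖r u y₁ y₂‖) (𝓝[≠] y₁) Filter.atTop) (u : ℂ) (hu : u ≠ 0) :
    ∃ N F, PD r u N F := by
  have k1 : DifferentiableOn ℂ (Function.uncurry (fun y t => r u y (y+t))) {p | p.2 ≠ 0} := by
    rintro ⟨y, t⟩ ht
    have ht' : t ≠ 0 := ht
    have := (hHolo.differentiableAt (b2_open.mem_nhds (x := (u, y, y + t)) ⟨hu, by simpa using ht'⟩)).comp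
      (f := fun p : ℂ × ℂ => (u, p.1, p.1 + p.2)) (x := (y,t)) (by fun_prop)
    exact this.differentiableWithinAt
  have k2 : ∀ y, MeromorphicAt (fun t => r u y (y+t)) 0 := by
    intro y
    have h1 : MeromorphicAt (fun y₂ => r u y y₂) (y + 0) := by simpa using hMero u hu y
    have : AnalyticAt ℂ (fun t => y + t) 0 := by fun_prop
    exact h1.comp_analyticAt this
  have k3 : Tendsto (fun t => ‖r u 0 (0+t)‖) (𝓝[≠] 0) atTop := by
    have := hPole u hu 0
    simpa using this
  obtain ⟨N, hN, F, h1, h2, h3, h4, h5⟩ := a2_main (fun y t => r u y (y+t)) k1 k2 k3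
  exact ⟨N, F, by omega, h1, h2, h3, h4, h5⟩

theorem b2_bijopen {n : ℕ} (r : ℂ → ℂ → ℂ → T2 n) (hHolo : IsHolomorphicOnDomain r) :
    IsOpen {p : ℂ × ℂ × ℂ | p.1 ≠ 0 ∧ p.2.1 ≠ p.2.2 ∧
      Function.Bijective (canMap (r p.1 p.2.1 p.2.2))} := by
  have h1 : ContinuousOn (fun p : ℂ × ℂ × ℂ => LinearMap.det (canLin (r p.1 p.2.1 p.2.2)))
      {p : ℂ × ℂ × ℂ | p.1 ≠ 0 ∧ p.2.1 ≠ p.2.2} := b1_detcont.comp_continuousOn hHolo.continuousOn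
  have := h1.isOpen_inter_preimage b2_open (t := {0}ᶜ) isOpen_compl_singleton
  convert this using 1
  ext p
  simp only [mem_ofPred_eq, mem_inter_iff, mem_preimage, mem_compl_iff, mem_singleton_iff, b1_bij, and_assoc, ne_eq]

theorem b2_step {n : ℕ} (r : ℂ → ℂ → ℂ → T2 n) (hA : IsAYBESolution r)
    (hHolo : IsHolomorphicOnDomain r) (u v y₁ y₂ : ℂ) (hu : u ≠ 0) (hv : v ≠ 0) (huv : u + v ≠ 0) (hy : y₁ ≠ y₂)
    (hb : Function.Bijective (canMap (r u y₁ y₂))) (N M : ℕ) (F G : ℂ → ℂ → T2 n)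
    (hF : PD r (u+v) N F) (hG : PD r v M G) :
    N = M ∧ (∀ y, F y 0 = G y 0) ∧ ∀ᶠ y in 𝓝 y₂, ∀ a p1 p2 q1 q2,
      G y 0 (p1, p2) (q1, q2) = if p1 = q2 then G y 0 (a, p2) (q1, a) else 0 := by
  set K := max N M with hK
  have hNK : N ≤ K := le_max_left _ _
  have hMK : M ≤ K := le_max_right _ _
  have hev : ∀ᶠ y in 𝓝 y₂, y₁ ≠ y ∧ Function.Bijective (canMap (r u y₁ y)) := by
    have : ContinuousAt (fun y => (u, y₁, y)) y₂ := by fun_prop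
    filter_upwards [this.preimage_mem_nhds ((b2_bijopen r hHolo).mem_nhds (x := (u, y₁, y₂)) ⟨hu, hy, hb⟩)] with y hy
    exact hy.2
  have hev2 : ∀ᶠ y in 𝓝 y₂, (0:ℂ)^(K-N) • F y 0 = (0:ℂ)^(K-M) • G y 0 ∧ ∀ a p1 p2 q1 q2,
      ((0:ℂ)^(K-N) • F y 0) (p1, p2) (q1, q2) = if p1 = q2 then ((0:ℂ)^(K-N) • F y 0) (a, p2) (q1, a) else 0 := by
    filter_upwards [hev] with y ⟨hy1, hyb⟩
    have hFc := (hF.dif y).continuous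
    have hGc := (hG.dif y).continuous
    have := b1_lim r hA hHolo u v y₁ y hu hv huv hy1 K (by have := hF.pos; omega)
      (fun t => t^(K-N) • F y t) (fun t => t^(K-M) • G y t) (by fun_prop) (by fun_prop) ?_ ?_
    · exact b1_alg _ _ _ hyb this
    · intro t ht
      rw [hF.eq y t ht, smul_smul, ← pow_add]
      congr 2; omega
    · intro t ht
      rw [hG.eq y t ht, smul_smul, ← pow_add]
      congr 2; omega
  have hall : ∀ y, (0:ℂ)^(K-N) • F y 0 = (0:ℂ)^(K-M) • G y 0 :=
    b2_ident (fun y => (0:ℂ)^(K-N) • F y 0) (fun y => (0:ℂ)^(K-M) • G y 0)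
      (hF.dif0.const_smul ((0:ℂ)^(K-N))) (hG.dif0.const_smul ((0:ℂ)^(K-M))) y₂ (hev2.mono fun y h => h.1)
  have hNM : N = M := by
    by_contra hne
    rcases lt_or_gt_of_ne hne with h | h
    · obtain ⟨y, hy⟩ := hG.ne
      have h1 : K - N ≠ 0 := by omega
      have h2 : K - M = 0 := by omega
      have := hall y
      simp [h1, h2] at this
      exact hy this.symm
    · obtain ⟨y, hy⟩ := hF.ne
      have h1 : K - M ≠ 0 := by omega
      have h2 : K - N = 0 := by omega
      have := hall y
      simp [h1, h2] at this
      exact hy this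
  have hKN : K - N = 0 := by omega
  have hKM : K - M = 0 := by omega
  simp only [hKN, hKM, pow_zero, one_smul] at hall hev2
  refine ⟨hNM, hall, hev2.mono fun y h => ?_⟩
  rw [← hall y]
  exact h.2

theorem b2_flip {n : ℕ} (r : ℂ → ℂ → ℂ → T2 n) (hUnit : IsUnitarySolution r)
    (u : ℂ) (hu : u ≠ 0) (N : ℕ) (F G : ℂ → ℂ → T2 n)
    (hF : PD r u N F) (hG : PD r (-u) N G) (hFG : ∀ y, F y 0 = G y 0) (y : ℂ) :
    tflip (F y 0) = (-(-1)^N : ℂ) • F y 0 := by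
  have h1 : Continuous (fun t => tflip (G (y+t) (-t))) := by
    have := hG.cont.comp (f := fun t : ℂ => (y + t, -t)) (by fun_prop)
    exact tflip_cont.comp this
  have h2 : Continuous (fun t => (-(-1)^N : ℂ) • F y t) := (hF.dif y).continuous.const_smul (-(-1)^N : ℂ)
  have h3 := (h1.tendsto 0).mono_left (nhdsWithin_le_nhds (s := {0}ᶜ))
  have h4 := (h2.tendsto 0).mono_left (nhdsWithin_le_nhds (s := {0}ᶜ))
  have := tendsto_nhds_unique h3 (h4.congr' ?_)
  · simpa [hFG] using this
  · filter_upwards [self_mem_nhdsWithin] with t ht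
    have ht0 : t ≠ 0 := ht
    rw [hG.eq _ _ (neg_ne_zero.2 ht0), hF.eq _ _ ht0, tflip_smul]
    have := hUnit u y (y+t) hu (by simpa using ht0)
    rw [show y + t + -t = y by ring, this, smul_neg, ← neg_smul, smul_smul, neg_pow t]
    congr 1; ring

theorem b2_unif {n : ℕ} (r : ℂ → ℂ → ℂ → T2 n)
    (hA : IsAYBESolution r) (hND : IsNonDegenerate r)
    (hHolo : IsHolomorphicOnDomain r)
    (N : ℂ → ℕ) (F : ℂ → ℂ → ℂ → T2 n) (hPD : ∀ u, u ≠ 0 → PD r u (N u) (F u))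
    (v w : ℂ) (hv : v ≠ 0) (hw : w ≠ 0) :
    N v = N w ∧ ∀ y, F v y 0 = F w y 0 := by
  set G := {p : ℂ × ℂ × ℂ | p.1 ≠ 0 ∧ p.2.1 ≠ p.2.2 ∧
      Function.Bijective (canMap (r p.1 p.2.1 p.2.2))} with hG
  have hGo : IsOpen G := b2_bijopen r hHolo
  set W := Prod.fst '' G with hW
  have hWo : IsOpen W := isOpenMap_fst _ hGo
  have hWd : Dense W := by
    have h1 : ({0}ᶜ : Set ℂ) ⊆ closure W := by
      intro u hu
      have h2 : (u, (0:ℂ), (1:ℂ)) ∈ closure G := hND ⟨hu, by simp⟩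
      exact image_closure_subset_closure_image continuous_fst ⟨_, h2, rfl⟩
    have h2 : Dense ({0}ᶜ : Set ℂ) := dense_compl_singleton 0
    have := h2.mono h1
    exact dense_closure.1 this
  have hstep : ∀ v, v ≠ 0 → ∀ z, z ≠ 0 → z - v ∈ W → N z = N v ∧ ∀ y, F z y 0 = F v y 0 := by
    rintro v hv z hz ⟨⟨u, y₁, y₂⟩, ⟨hu, hy, hb⟩, huz⟩
    simp only at hu hy hb huz
    have huv : u + v = z := by rw [huz]; ring
    have := b2_step r hA hHolo u v y₁ y₂ hu hv (by rwa [huv]) hy hb (N z) (N v) (F z) (F v)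
      (by rw [huv]; exact hPD z hz) (hPD v hv)
    exact ⟨this.1, this.2.1⟩
  have hd : ∀ v : ℂ, Dense ((fun z => z - v) ⁻¹' W) ∧ IsOpen ((fun z => z - v) ⁻¹' W) := fun v =>
    ⟨hWd.preimage (Homeomorph.subRight v).isOpenMap, hWo.preimage (by fun_prop)⟩
  have hdd := ((hd v).1.inter_of_isOpen_left (hd w).1 (hd v).2)
  have hdd2 := hdd.inter_of_isOpen_left (dense_compl_singleton (0:ℂ)) ((hd v).2.inter (hd w).2)
  obtain ⟨z, ⟨hz1, hz2⟩, hz0⟩ := hdd2.nonempty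
  obtain ⟨a1, a2⟩ := hstep v hv z hz0 hz1
  obtain ⟨b1, b2⟩ := hstep w hw z hz0 hz2
  exact ⟨a1.symm.trans b1, fun y => (a2 y).symm.trans (b2 y)⟩

theorem b2_simple {n : ℕ} (o : Fin n) (r : ℂ → ℂ → ℂ → T2 n) (hA : IsAYBESolution r)
    (N : ℕ) (F : ℂ → ℂ → ℂ → T2 n) (hPD : ∀ u, u ≠ 0 → PD r u N (F u)) (y α : ℂ) (hα : α ≠ 0)
    (h : ∀ u, u ≠ 0 → F u y 0 = α • Pmat n) : N = 1 := by
  have hc : ∀ u, u ≠ 0 → ∀ (a b : ℂ → ℂ), Continuous a → Continuous b → Continuous (fun t => F u (a t) (b t)) :=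
    fun u hu a b ha hb => (hPD u hu).cont.comp (ha.prodMk hb)
  have h1 : Continuous (fun t : ℂ => (2:ℂ)^N • (emb12 (F 1 y t) * emb23 (F 2 (y+t) t))) := by
    have a := hc 1 one_ne_zero (fun _ => y) (fun t => t) (by fun_prop) (by fun_prop)
    have b := hc 2 two_ne_zero (fun t => y+t) (fun t => t) (by fun_prop) (by fun_prop)
    exact (((emb12_cont.comp a).mul (emb23_cont.comp b))).const_smul ((2:ℂ)^N)
  have h2 : Continuous (fun t : ℂ => emb13 (F 2 y (2*t)) * emb12 (F (-1) y t) + emb23 (F 1 (y+t) t) * emb13 (F 1 y (2*t))) := by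
    have a := hc 2 two_ne_zero (fun _ => y) (fun t => 2*t) (by fun_prop) (by fun_prop)
    have b := hc (-1) (by norm_num) (fun t => y) (fun t => t) (by fun_prop) (by fun_prop)
    have c := hc 1 one_ne_zero (fun t => y+t) (fun t => t) (by fun_prop) (by fun_prop)
    have d := hc 1 one_ne_zero (fun _ => y) (fun t => 2*t) (by fun_prop) (by fun_prop)
    exact ((emb13_cont.comp a).mul (emb12_cont.comp b)).add ((emb23_cont.comp c).mul (emb13_cont.comp d))
  have h3 := (h1.tendsto 0).mono_left (nhdsWithin_le_nhds (s := {0}ᶜ))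
  have h4 := (h2.tendsto 0).mono_left (nhdsWithin_le_nhds (s := {0}ᶜ))
  have key := tendsto_nhds_unique h3 (h4.congr' ?_)
  · simp only [add_zero, mul_zero] at key
    rw [h 1 one_ne_zero, h 2 two_ne_zero, h (-1) (by norm_num)] at key
    simp only [emb12_smul, emb13_smul, emb23_smul, Matrix.mul_smul, Matrix.smul_mul] at key
    have := congrFun (congrFun key (o, o, o)) (o, o, o)
    simp only [Matrix.add_apply, Matrix.smul_apply, b1_1223, b1_1312, b1_2313, b1_P] at this
    simp at this
    have h5 : (2:ℂ)^N = 2 := by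
      have h6 : (2:ℂ)^N * (α * α) = 2 * (α * α) := by rw [this]; ring
      exact mul_right_cancel₀ (mul_ne_zero hα hα) h6
    have h7 : (2:ℕ)^N = 2^1 := by exact_mod_cast h5
    exact Nat.pow_right_injective le_rfl h7
  · filter_upwards [self_mem_nhdsWithin] with t ht
    have ht0 : t ≠ 0 := ht
    have e2 : 2 * t ≠ 0 := mul_ne_zero two_ne_zero ht0
    rw [(hPD 1 one_ne_zero).eq _ _ ht0, (hPD 1 one_ne_zero).eq _ _ ht0, (hPD 1 one_ne_zero).eq _ _ e2,
      (hPD 2 two_ne_zero).eq _ _ ht0, (hPD 2 two_ne_zero).eq _ _ e2, (hPD (-1) (by norm_num)).eq _ _ ht0]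
    have := hA 1 1 y (y+t) (y+2*t) one_ne_zero one_ne_zero (by norm_num) (by simpa using ht0) (by simpa using ht0)
      (by intro h; apply ht0; linear_combination -h)
    rw [show y + t + t = y + 2*t by ring]
    rw [show (1:ℂ)+1 = 2 by norm_num] at this
    simp only [emb12_smul, emb13_smul, emb23_smul, Matrix.mul_smul, Matrix.smul_mul, smul_smul]
    rw [this, smul_add]
    congr 2 <;> ring

theorem b2_main {n : ℕ} (hn : 2 ≤ n) (r : ℂ → ℂ → ℂ → T2 n)
    (hA : IsAYBESolution r) (hUnit : IsUnitarySolution r) (hND : IsNonDegenerate r)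
    (hHolo : IsHolomorphicOnDomain r) (hMero : IsMeromorphicAlongDiagonal r)
    (hPole : ∀ u : ℂ, u ≠ 0 → ∀ y₁ : ℂ,
      Filter.Tendsto (fun y₂ => ‖r u y₁ y₂‖) (𝓝[≠] y₁) Filter.atTop) :
    ∃ (c : ℂ → ℂ) (F : ℂ → ℂ → ℂ → T2 n), Differentiable ℂ c ∧ (∀ y, c y ≠ 0) ∧
      ∀ u, u ≠ 0 → PD r u 1 (F u) ∧ ∀ y, F u y 0 = c y • Pmat n := by
  have hex := b2_exists r hHolo hMero hPole
  have hex' : ∀ u : ℂ, ∃ N F, u ≠ 0 → PD r u N F := by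
    intro u
    by_cases hu : u = 0
    · exact ⟨0, fun _ _ => 0, fun h => absurd hu h⟩
    · obtain ⟨N, F, h⟩ := hex u hu; exact ⟨N, F, fun _ => h⟩
  choose Nu F hPDu using hex'
  have hun := b2_unif r hA hND hHolo Nu F hPDu
  set N := Nu 1 with hN
  have hPD : ∀ u, u ≠ 0 → PD r u N (F u) := fun u hu => by
    have := hPDu u hu; rwa [(hun u 1 hu one_ne_zero).1] at this
  have hF1 : ∀ u, u ≠ 0 → ∀ y, F u y 0 = F 1 y 0 := fun u hu y => (hun u 1 hu one_ne_zero).2 y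
  have hflip := b2_flip r hUnit 1 one_ne_zero N (F 1) (F (-1)) (hPD 1 one_ne_zero) (hPD (-1) (by norm_num))
    (fun y => (hF1 (-1) (by norm_num) y).symm)
  let o : Fin n := ⟨0, by omega⟩
  let c : ℂ → ℂ := fun y => F 1 y 0 (o, o) (o, o)
  have hcd : Differentiable ℂ c := by
    have h0 := (hPD 1 one_ne_zero).dif0
    let L : T2 n →ₗ[ℂ] ℂ := Matrix.entryLinearMap ℂ ℂ (o,o) (o,o)
    exact (LinearMap.toContinuousLinearMap L).differentiable.comp h0
  obtain ⟨u0, y10, y20, hu0, huv0, hy0, hb0⟩ : ∃ u y₁ y₂ : ℂ, u ≠ 0 ∧ u + 1 ≠ 0 ∧ y₁ ≠ y₂ ∧ Function.Bijective (canMap (r u y₁ y₂)) := by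
    have h2 := hND (show ((1:ℂ), (0:ℂ), (1:ℂ)) ∈ _ from ⟨one_ne_zero, by simp⟩)
    have ho : IsOpen {p : ℂ × ℂ × ℂ | p.1 ≠ -1} := isOpen_ne.preimage continuous_fst
    obtain ⟨⟨u, y₁, y₂⟩, h3, h4, h5, h6⟩ := mem_closure_iff.1 h2 _ ho (by show (1:ℂ) ≠ -1; norm_num)
    exact ⟨u, y₁, y₂, h4, fun h => h3 (by linear_combination h), h5, h6⟩
  have hst := (b2_step r hA hHolo u0 1 y10 y20 hu0 one_ne_zero huv0 hy0 hb0 N N (F (u0+1)) (F 1)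
    (hPD _ huv0) (hPD 1 one_ne_zero)).2.2
  have hcP : ∀ y, F 1 y 0 = c y • Pmat n := by
    refine b2_ident _ _ (hPD 1 one_ne_zero).dif0 (hcd.smul_const _) y20 ?_
    filter_upwards [hst] with y hy
    exact b1_form o _ _ hy (hflip y)
  have hcP' : ∀ u, u ≠ 0 → ∀ y, F u y 0 = c y • Pmat n := fun u hu y => by rw [hF1 u hu y, hcP y]
  have hN1 : N = 1 := by
    obtain ⟨y, hy⟩ := (hPD 1 one_ne_zero).ne
    refine b2_simple o r hA N F hPD y (c y) ?_ (fun u hu => hcP' u hu y)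
    intro h0
    rw [hcP y, h0, zero_smul] at hy
    exact hy rfl
  rw [hN1] at hPD
  refine ⟨c, F, hcd, ?_, fun u hu => ⟨hPD u hu, hcP' u hu⟩⟩
  intro y hy
  have hP1 := hPD 1 one_ne_zero
  obtain ⟨φ, hφ, hφe⟩ := a2_down (fun t => r 1 y (y+t)) 0 (F 1 y) (hP1.dif y) (hP1.eq y) (by rw [hcP, hy, zero_smul])
  have h1 := hPole 1 one_ne_zero y
  have h2 : Tendsto (fun z => ‖φ (z - y)‖) (𝓝[≠] y) (𝓝 ‖φ (y - y)‖) := by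
    have : Continuous (fun z => ‖φ (z - y)‖) := by have := hφ.continuous; fun_prop
    exact (this.tendsto y).mono_left nhdsWithin_le_nhds
  refine not_tendsto_atTop_of_tendsto_nhds h2 (h1.congr' ?_)
  filter_upwards [self_mem_nhdsWithin] with z hz
  rw [hφe (z - y) (sub_ne_zero.2 hz)]
  simp

theorem c1_deq {E : Type*} [NormedAddCommGroup E] [NormedSpace ℂ E] (f g : ℂ → E) (a b : E)
    (hf : HasDerivAt f a 0) (hg : HasDerivAt g b 0) (h : ∀ᶠ t in 𝓝[≠] (0:ℂ), f t = g t) : a = b := by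
  have h0 : f 0 = g 0 :=
    tendsto_nhds_unique (hf.continuousAt.tendsto.mono_left nhdsWithin_le_nhds)
      ((hg.continuousAt.tendsto.mono_left (nhdsWithin_le_nhds (s := {0}ᶜ))).congr' (h.mono fun t ht => ht.symm))
  have h1 : f =ᶠ[𝓝 0] g := by
    rw [eventually_nhdsWithin_iff] at h
    filter_upwards [h] with t ht
    by_cases h2 : t = 0
    · rw [h2, h0]
    · exact ht h2
  exact hf.unique (hg.congr_of_eventuallyEq h1)

theorem c1_smul {E : Type*} [NormedAddCommGroup E] [NormedSpace ℂ E] (g : ℂ → E)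
    (hg : ContinuousAt g 0) : HasDerivAt (fun t : ℂ => t • g t) (g 0) 0 := by
  rw [hasDerivAt_iff_tendsto_slope]
  refine (hg.tendsto.mono_left nhdsWithin_le_nhds).congr' ?_
  filter_upwards [self_mem_nhdsWithin] with t ht
  have ht0 : t ≠ 0 := ht
  rw [slope_def_module]
  simp [smul_smul, ht0]

theorem c1_mul {ι : Type*} [Fintype ι] [DecidableEq ι] (A B : ℂ → Matrix ι ι ℂ) (A' B' : Matrix ι ι ℂ) (t : ℂ)
    (hA : HasDerivAt A A' t) (hB : HasDerivAt B B' t) :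
    HasDerivAt (fun s => A s * B s) (A' * B t + A t * B') t := by
  have hA1 : ∀ i j, HasDerivAt (fun s => A s i j) (A' i j) t := fun i j =>
    hasDerivAt_pi.1 (hasDerivAt_pi.1 hA i) j
  have hB1 : ∀ i j, HasDerivAt (fun s => B s i j) (B' i j) t := fun i j =>
    hasDerivAt_pi.1 (hasDerivAt_pi.1 hB i) j
  refine hasDerivAt_pi.2 fun i => hasDerivAt_pi.2 fun j => ?_
  simp only [Matrix.mul_apply, Matrix.add_apply]
  rw [← Finset.sum_add_distrib]
  exact HasDerivAt.fun_sum fun k _ => (hA1 i k).mul (hB1 k j)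

theorem c1_jac {ι : Type*} [Fintype ι] [DecidableEq ι] (M : Matrix ι ι ℂ) :
    ∃ L : Matrix ι ι ℂ →L[ℂ] ℂ, HasFDerivAt (fun N : Matrix ι ι ℂ => N.det) L M ∧
      ∀ N, L N = (M.adjugate * N).trace := by
  let D : ContinuousMultilinearMap ℂ (fun _ : ι => ι → ℂ) ℂ :=
    { (Matrix.detRowAlternating (n := ι) (R := ℂ)).toMultilinearMap with
      cont := by
        show Continuous (fun N : Matrix ι ι ℂ => N.det)
        exact continuous_id.matrix_det }
  refine ⟨D.linearDeriv M, D.hasFDerivAt M, fun N => ?_⟩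
  have hL : (D.linearDeriv M) N = ∑ i, D (Function.update M i (N i)) :=
    ContinuousMultilinearMap.linearDeriv_apply (f := D) (x := (M : ι → ι → ℂ)) (y := N)
  have : ∀ i, D (Function.update M i (N i)) = ∑ j, M.adjugate j i * N i j := by
    intro i
    show (M.updateRow i (N i)).det = _
    rw [← Matrix.cramer_transpose_apply, Matrix.cramer_eq_adjugate_mulVec,
      ← Matrix.adjugate_transpose]
    rfl
  refine hL.trans ?_
  calc _ = ∑ i, ∑ j, M.adjugate j i * N i j := Finset.sum_congr rfl fun i _ => this i
    _ = _ := by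
      rw [Finset.sum_comm]
      simp [Matrix.trace, Matrix.mul_apply]

/-- contraction operators -/
def l1 (n : ℕ) : T2 n →ₗ[ℂ] T2 n where
  toFun T := Matrix.of fun p q => (∑ k, T (p.1, k) (k, q.1)) * if p.2 = q.2 then 1 else 0
  map_add' x y := by ext; simp only [Matrix.of_apply, Matrix.add_apply, Finset.sum_add_distrib, add_mul]
  map_smul' c x := by
    ext
    simp only [Matrix.of_apply, Matrix.smul_apply, smul_eq_mul, RingHom.id_apply, ← Finset.mul_sum, mul_assoc]

def l2 (n : ℕ) : T2 n →ₗ[ℂ] T2 n where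
  toFun T := Matrix.of fun p q => (∑ k, T (p.2, k) (k, q.2)) * if p.1 = q.1 then 1 else 0
  map_add' x y := by ext; simp only [Matrix.of_apply, Matrix.add_apply, Finset.sum_add_distrib, add_mul]
  map_smul' c x := by
    ext
    simp only [Matrix.of_apply, Matrix.smul_apply, smul_eq_mul, RingHom.id_apply, ← Finset.mul_sum, mul_assoc]

theorem l1_apply {n : ℕ} (T : T2 n) (p q : Fin n × Fin n) :
    l1 n T p q = (∑ k, T (p.1, k) (k, q.1)) * if p.2 = q.2 then 1 else 0 := rfl
theorem l2_apply {n : ℕ} (T : T2 n) (p q : Fin n × Fin n) :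
    l2 n T p q = (∑ k, T (p.2, k) (k, q.2)) * if p.1 = q.1 then 1 else 0 := rfl

def yy {n : ℕ} (R T : T2 n) : T2 n :=
  Matrix.of fun p q => ∑ k, ∑ s, R (p.1, k) (s, q.2) * T (s, p.2) (q.1, k)

def tau {n : ℕ} (T : T2 n) : ℂ := ∑ i, ∑ k, T (i, k) (k, i)

theorem l1_trace {n : ℕ} (T : T2 n) : (l1 n T).trace = n * tau T := by
  simp only [Matrix.trace, Matrix.diag_apply, l1_apply, Fintype.sum_prod_type, tau]
  simp [Finset.mul_sum]
theorem l2_trace {n : ℕ} (T : T2 n) : (l2 n T).trace = n * tau T := by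
  simp only [Matrix.trace, Matrix.diag_apply, l2_apply, Fintype.sum_prod_type, tau]
  simp
theorem l1_P (n : ℕ) : l1 n (Pmat n) = (n:ℂ) • 1 := by
  ext ⟨p1, p2⟩ ⟨q1, q2⟩
  rw [l1_apply]
  simp only [b1_P, Matrix.smul_apply, Matrix.one_apply, Prod.mk.injEq]
  by_cases h1 : p1 = q1 <;> by_cases h2 : p2 = q2 <;> simp [h1, h2]
theorem l2_P (n : ℕ) : l2 n (Pmat n) = (n:ℂ) • 1 := by
  ext ⟨p1, p2⟩ ⟨q1, q2⟩
  rw [l2_apply]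
  simp only [b1_P, Matrix.smul_apply, Matrix.one_apply, Prod.mk.injEq]
  by_cases h1 : p1 = q1 <;> by_cases h2 : p2 = q2 <;> simp [h1, h2]

theorem l1_mul {n : ℕ} (A B : T2 n) (p q : Fin n × Fin n) :
    (l1 n A * B) p q = ∑ k, ∑ s, A (p.1, k) (k, s) * B (s, p.2) q := by
  simp only [Matrix.mul_apply, Fintype.sum_prod_type, l1_apply]
  rw [Finset.sum_comm (s := Finset.univ) (t := Finset.univ) (f := fun k s => A (p.1, k) (k, s) * B (s, p.2) q)]
  refine Finset.sum_congr rfl fun s _ => ?_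
  rw [Finset.sum_eq_single p.2]
  · simp [Finset.sum_mul]
  · intro b _ hb; simp [hb.symm]
  · simp
theorem mul_l1 {n : ℕ} (A B : T2 n) (p q : Fin n × Fin n) :
    (A * l1 n B) p q = ∑ k, ∑ s, A p (s, q.2) * B (s, k) (k, q.1) := by
  simp only [Matrix.mul_apply, Fintype.sum_prod_type, l1_apply]
  rw [Finset.sum_comm (s := Finset.univ) (t := Finset.univ) (f := fun k s => A p (s, q.2) * B (s, k) (k, q.1))]
  refine Finset.sum_congr rfl fun s _ => ?_
  rw [Finset.sum_eq_single q.2]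
  · simp [Finset.mul_sum]
  · intro b _ hb; simp [hb]
  · simp
theorem l2_mul {n : ℕ} (A B : T2 n) (p q : Fin n × Fin n) :
    (l2 n A * B) p q = ∑ k, ∑ s, A (p.2, k) (k, s) * B (p.1, s) q := by
  simp only [Matrix.mul_apply, Fintype.sum_prod_type, l2_apply]
  rw [Finset.sum_comm (s := Finset.univ) (t := Finset.univ) (f := fun k s => A (p.2, k) (k, s) * B (p.1, s) q)]
  rw [Finset.sum_eq_single p.1]
  · simp [Finset.sum_mul]
  · intro b _ hb; simp [hb.symm]
  · simp
theorem mul_l2 {n : ℕ} (A B : T2 n) (p q : Fin n × Fin n) :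
    (A * l2 n B) p q = ∑ k, ∑ s, A p (q.1, s) * B (s, k) (k, q.2) := by
  simp only [Matrix.mul_apply, Fintype.sum_prod_type, l2_apply]
  rw [Finset.sum_comm (s := Finset.univ) (t := Finset.univ) (f := fun k s => A p (q.1, s) * B (s, k) (k, q.2))]
  rw [Finset.sum_eq_single q.1]
  · simp [Finset.mul_sum]
  · intro b _ hb; simp [hb]
  · simp

theorem c1_A {n : ℕ} (R1 R2 R3 R4 R5 R6 : T2 n)
    (h : emb12 R1 * emb23 R2 = emb13 R3 * emb12 R4 + emb23 R5 * emb13 R6) :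
    l1 n R1 * R2 = R3 * l1 n R4 + yy R6 R5 := by
  ext ⟨p1, p3⟩ ⟨q1, q3⟩
  have h1 : ∀ k, (emb12 R1 * emb23 R2) (p1, k, p3) (k, q1, q3) = (emb13 R3 * emb12 R4 + emb23 R5 * emb13 R6) (p1, k, p3) (k, q1, q3) :=
    fun k => by rw [h]
  have h2 := Finset.sum_congr (s₁ := Finset.univ) rfl fun k _ => h1 k
  simp only [Matrix.add_apply, b1_1223, b1_1312, b1_2313, Finset.sum_add_distrib] at h2
  rw [Matrix.add_apply, l1_mul, mul_l1, h2]
  congr 1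
  simp only [yy, Matrix.of_apply]
  rw [Finset.sum_comm]
  refine Finset.sum_congr rfl fun k _ => Finset.sum_congr rfl fun s _ => by ring

theorem c1_B {n : ℕ} (R1 R2 R3 R4 R5 R6 : T2 n)
    (h : emb12 R1 * emb23 R2 = emb13 R3 * emb12 R4 + emb23 R5 * emb13 R6) :
    R1 * l2 n R2 = yy R3 R4 + l2 n R5 * R6 := by
  ext ⟨p1, p2⟩ ⟨q1, q2⟩
  have h1 : ∀ k, (emb12 R1 * emb23 R2) (p1, p2, k) (q1, k, q2) = (emb13 R3 * emb12 R4 + emb23 R5 * emb13 R6) (p1, p2, k) (q1, k, q2) :=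
    fun k => by rw [h]
  have h2 := Finset.sum_congr (s₁ := Finset.univ) rfl fun k _ => h1 k
  simp only [Matrix.add_apply, b1_1223, b1_1312, b1_2313, Finset.sum_add_distrib] at h2
  rw [Matrix.add_apply, l2_mul, mul_l2, h2]
  rfl

theorem yy_cont {n : ℕ} : Continuous (fun p : T2 n × T2 n => yy p.1 p.2) := by
  refine continuous_matrix fun i j => ?_
  simp only [yy, Matrix.of_apply]
  refine continuous_finsetSum _ fun k _ => continuous_finsetSum _ fun s _ => ?_
  exact (Continuous.matrix_elem continuous_fst _ _).mul (Continuous.matrix_elem continuous_snd _ _)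

theorem yy_smul_left {n : ℕ} (c : ℂ) (R T : T2 n) : yy (c • R) T = c • yy R T := by
  ext; simp [yy, Finset.mul_sum, mul_assoc]
theorem yy_smul_right {n : ℕ} (c : ℂ) (R T : T2 n) : yy R (c • T) = c • yy R T := by
  ext; simp [yy, Finset.mul_sum, mul_left_comm]

theorem P_sq (n : ℕ) : Pmat n * Pmat n = 1 := by
  ext ⟨p1, p2⟩ ⟨q1, q2⟩
  simp only [Matrix.mul_apply, b1_P, Fintype.sum_prod_type, Matrix.one_apply, Prod.mk.injEq]
  rw [Finset.sum_eq_single p2, Finset.sum_eq_single p1]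
  · by_cases h1 : p1 = q1 <;> by_cases h2 : p2 = q2 <;> simp [h1, h2]
  · intro b _ hb; simp [hb.symm]
  · simp
  · intro b _ hb; simp [hb.symm]
  · simp

theorem c2_lin {n : ℕ} (l : T2 n →ₗ[ℂ] T2 n) (f : ℂ → T2 n) (f' : T2 n) (t : ℂ)
    (h : HasDerivAt f f' t) : HasDerivAt (fun s => l (f s)) (l f') t :=
  (LinearMap.toContinuousLinearMap l).hasFDerivAt.comp_hasDerivAt t h

theorem c2_rdiff {n : ℕ} (r : ℂ → ℂ → ℂ → T2 n) (hHolo : IsHolomorphicOnDomain r) (u : ℂ) (hu : u ≠ 0)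
    (x y : ℂ) (hxy : x ≠ y) : DifferentiableAt ℂ (fun p : ℂ × ℂ => r u p.1 p.2) (x, y) := by
  have h1 : DifferentiableAt ℂ (fun p : ℂ × ℂ × ℂ => r p.1 p.2.1 p.2.2) (u, x, y) :=
    hHolo.differentiableAt (b2_open.mem_nhds ⟨hu, hxy⟩)
  have h2 : DifferentiableAt ℂ (fun p : ℂ × ℂ => (u, p.1, p.2)) (x, y) := by fun_prop
  exact DifferentiableAt.comp (x, y) h1 h2

theorem c2_d1 {n : ℕ} (R : ℂ × ℂ → T2 n) (x y : ℂ) (h : DifferentiableAt ℂ R (x, y)) :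
    HasDerivAt (fun t : ℂ => R (x + t, y)) (fderiv ℂ R (x, y) (1, 0)) 0 := by
  have h2 : HasDerivAt (fun t : ℂ => ((x + t, y) : ℂ × ℂ)) ((1 : ℂ), (0 : ℂ)) 0 :=
    ((hasDerivAt_id (0:ℂ)).const_add x).prodMk (hasDerivAt_const 0 y)
  have h3 : HasFDerivAt R (fderiv ℂ R (x, y)) (x + 0, y) := by rw [add_zero]; exact h.hasFDerivAt
  exact h3.comp_hasDerivAt (0:ℂ) h2

theorem c2_d2 {n : ℕ} (R : ℂ × ℂ → T2 n) (x y : ℂ) (h : DifferentiableAt ℂ R (x, y)) :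
    HasDerivAt (fun t : ℂ => R (x, y + t)) (fderiv ℂ R (x, y) (0, 1)) 0 := by
  have h2 : HasDerivAt (fun t : ℂ => ((x, y + t) : ℂ × ℂ)) ((0 : ℂ), (1 : ℂ)) 0 :=
    (hasDerivAt_const 0 x).prodMk ((hasDerivAt_id (0:ℂ)).const_add y)
  have h3 : HasFDerivAt R (fderiv ℂ R (x, y)) (x, y + 0) := by rw [add_zero]; exact h.hasFDerivAt
  exact h3.comp_hasDerivAt (0:ℂ) h2

theorem c2_yy {n : ℕ} (A B : ℂ → T2 n) (t : ℂ) (hA : ContinuousAt A t) (hB : ContinuousAt B t) :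
    ContinuousAt (fun s => yy (A s) (B s)) t :=
  ContinuousAt.comp (f := fun s => (A s, B s)) (g := fun p : T2 n × T2 n => yy p.1 p.2)
    yy_cont.continuousAt (hA.prodMk hB)

theorem c2_ne (x y : ℂ) (hxy : x ≠ y) : ∀ᶠ t in 𝓝[≠] (0:ℂ), t ≠ 0 ∧ x + t ≠ y := by
  have h1 : ∀ᶠ t in 𝓝 (0:ℂ), x + t ≠ y := by
    have : ContinuousAt (fun t : ℂ => x + t) 0 := by fun_prop
    exact this.eventually_ne (by simpa using hxy)
  filter_upwards [self_mem_nhdsWithin, h1.filter_mono nhdsWithin_le_nhds] with t ht h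
  exact ⟨ht, h⟩

section
variable {n : ℕ} (r : ℂ → ℂ → ℂ → T2 n) (hA : IsAYBESolution r) (hHolo : IsHolomorphicOnDomain r)
  (c : ℂ → ℂ) (F : ℂ → ℂ → ℂ → T2 n)
  (hF : ∀ u, u ≠ 0 → PD r u 1 (F u) ∧ ∀ y, F u y 0 = c y • Pmat n)

theorem c2_der (hF : ∀ u, u ≠ 0 → PD r u 1 (F u) ∧ ∀ y, F u y 0 = c y • Pmat n) (u : ℂ) (hu : u ≠ 0) (y : ℂ) :
    HasDerivAt (F u y) (deriv (F u y) 0) 0 := ((hF u hu).1.dif y 0).hasDerivAt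

theorem c2_eq1 (hA : IsAYBESolution r) (hHolo : IsHolomorphicOnDomain r)
    (hF : ∀ u, u ≠ 0 → PD r u 1 (F u) ∧ ∀ y, F u y 0 = c y • Pmat n) (x y : ℂ) (hxy : x ≠ y) :
    l1 n (deriv (F 1 x) 0) * r 2 x y + (c x * n) • fderiv ℂ (fun p : ℂ × ℂ => r 2 p.1 p.2) (x, y) (1, 0)
      = r 2 x y * l1 n (deriv (F (-1) x) 0) + yy (r 1 x y) (r 1 x y) := by
  have hR := c2_rdiff r hHolo 2 two_ne_zero x y hxy
  have hR1 := c2_rdiff r hHolo 1 one_ne_zero x y hxy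
  have e1 := c2_lin (l1 n) _ _ _ (c2_der r c F hF 1 one_ne_zero x)
  have e2 := c2_lin (l1 n) _ _ _ (c2_der r c F hF (-1) (neg_ne_zero.2 one_ne_zero) x)
  have d1 := c2_d1 _ x y hR
  have hc : ContinuousAt (fun t : ℂ => yy (r 1 x y) (r 1 (x + t) y)) 0 := by
    have h1 := (c2_d1 _ x y hR1).continuousAt
    exact c2_yy (fun _ => r 1 x y) (fun t => r 1 (x + t) y) 0 continuousAt_const h1
  have key := c1_deq _ _ _ _ (c1_mul _ _ _ _ _ e1 d1)
    ((c1_mul _ _ _ _ _ (hasDerivAt_const (0:ℂ) (r 2 x y)) e2).add (c1_smul _ hc)) (by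
      filter_upwards [c2_ne x y hxy] with t ht
      obtain ⟨ht, hty⟩ := ht
      have hxt : x ≠ x + t := by simpa using ht
      have h := c1_A _ _ _ _ _ _ (hA 1 1 x (x+t) y one_ne_zero one_ne_zero (by norm_num) hxt hxy hty)
      show l1 n (F 1 x t) * r 2 (x+t) y = r 2 x y * l1 n (F (-1) x t) + t • yy (r 1 x y) (r 1 (x+t) y)
      rw [(hF 1 one_ne_zero).1.eq x t ht, (hF (-1) (neg_ne_zero.2 one_ne_zero)).1.eq x t ht, pow_one,
        map_smul, map_smul, Matrix.smul_mul, Matrix.mul_smul, ← smul_add]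
      rw [one_add_one_eq_two] at h
      rw [h])
  simp only [add_zero, Matrix.zero_mul, zero_add, (hF 1 one_ne_zero).2, map_smul, l1_P, smul_smul,
    Matrix.smul_mul, Matrix.one_mul] at key
  exact key

theorem c2_eq2 (hA : IsAYBESolution r) (hHolo : IsHolomorphicOnDomain r)
    (hF : ∀ u, u ≠ 0 → PD r u 1 (F u) ∧ ∀ y, F u y 0 = c y • Pmat n) (x y : ℂ) (hxy : x ≠ y) :
    r 2 x y * l2 n (deriv (F 1 y) 0)
      = yy (r 1 x y) (r 1 x y) + (l2 n (deriv (F (-1) y) 0) * r 2 x y +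
        (c y * n) • fderiv ℂ (fun p : ℂ × ℂ => r 2 p.1 p.2) (x, y) (0, 1)) := by
  have hR := c2_rdiff r hHolo 2 two_ne_zero x y hxy
  have hR1 := c2_rdiff r hHolo 1 one_ne_zero x y hxy
  have e1 := c2_lin (l2 n) _ _ _ (c2_der r c F hF 1 one_ne_zero y)
  have e2 := c2_lin (l2 n) _ _ _ (c2_der r c F hF (-1) (neg_ne_zero.2 one_ne_zero) y)
  have d1 := c2_d2 _ x y hR
  have hc : ContinuousAt (fun t : ℂ => yy (r 1 x (y + t)) (r 1 x y)) 0 := by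
    have h1 := (c2_d2 _ x y hR1).continuousAt
    exact c2_yy (fun t => r 1 x (y + t)) (fun _ => r 1 x y) 0 h1 continuousAt_const
  have key := c1_deq _ _ _ _ (c1_mul _ _ _ _ _ (hasDerivAt_const (0:ℂ) (r 2 x y)) e1)
    ((c1_smul _ hc).add (c1_mul _ _ _ _ _ e2 d1)) (by
      filter_upwards [c2_ne y x hxy.symm] with t ht
      obtain ⟨ht, hty⟩ := ht
      have hxt : y ≠ y + t := by simpa using ht
      have h := c1_B _ _ _ _ _ _ (hA 2 (-1) x y (y+t) two_ne_zero (neg_ne_zero.2 one_ne_zero) (by norm_num) hxy hty.symm hxt)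
      show r 2 x y * l2 n (F 1 y t) = t • yy (r 1 x (y+t)) (r 1 x y) + l2 n (F (-1) y t) * r 2 x (y+t)
      rw [(hF 1 one_ne_zero).1.eq y t ht, (hF (-1) (neg_ne_zero.2 one_ne_zero)).1.eq y t ht, pow_one,
        map_smul, map_smul, Matrix.smul_mul, Matrix.mul_smul, ← smul_add]
      have e3 : (2 : ℂ) + -1 = 1 := by norm_num
      rw [e3, neg_neg] at h
      rw [h])
  simp only [add_zero, Matrix.zero_mul, zero_add, (hF (-1) (neg_ne_zero.2 one_ne_zero)).2, map_smul, l2_P, smul_smul,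
    Matrix.smul_mul, Matrix.one_mul] at key
  exact key

theorem c2_det (hn : 2 ≤ n) (hA : IsAYBESolution r) (hHolo : IsHolomorphicOnDomain r)
    (hF : ∀ u, u ≠ 0 → PD r u 1 (F u) ∧ ∀ y, F u y 0 = c y • Pmat n) :
    ∃ σ : ℂ → ℂ, ∀ x y, x ≠ y → ∃ L : ℂ × ℂ →L[ℂ] ℂ,
      HasFDerivAt (fun p : ℂ × ℂ => (r 2 p.1 p.2).det) L (x, y) ∧
      L (c x, c y) = (r 2 x y).det * (σ y - σ x) := by
  refine ⟨fun y => tau (deriv (F 1 y) 0) - tau (deriv (F (-1) y) 0), fun x y hxy => ?_⟩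
  have hR := c2_rdiff r hHolo 2 two_ne_zero x y hxy
  obtain ⟨J, hJ, hJ2⟩ := c1_jac (r 2 x y)
  have q1 := c2_eq1 r c F hA hHolo hF x y hxy
  have q2 := c2_eq2 r c F hA hHolo hF x y hxy
  refine ⟨J.comp (fderiv ℂ (fun p : ℂ × ℂ => r 2 p.1 p.2) (x, y)),
    HasFDerivAt.comp (x, y) (g := fun N : T2 n => N.det) hJ hR.hasFDerivAt, ?_⟩
  set D := fderiv ℂ (fun p : ℂ × ℂ => r 2 p.1 p.2) (x, y)
  set R := r 2 x y
  have hn0 : (n : ℂ) ≠ 0 := by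
    have : n ≠ 0 := by omega
    exact_mod_cast this
  have e0 : D (c x, c y) = c x • D (1, 0) + c y • D (0, 1) := by
    rw [← map_smul, ← map_smul, ← map_add]; simp
  have e1 : (n : ℂ) • D (c x, c y) = R * (l1 n (deriv (F (-1) x) 0) + l2 n (deriv (F 1 y) 0))
      - (l1 n (deriv (F 1 x) 0) + l2 n (deriv (F (-1) y) 0)) * R := by
    rw [Matrix.mul_add, Matrix.add_mul, q2, e0, smul_add, smul_smul, smul_smul, mul_comm (n:ℂ), mul_comm (n:ℂ)]
    rw [eq_sub_of_add_eq' q1]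
    abel
  have e2 : ∀ Z : T2 n, (R.adjugate * (R * Z)).trace = R.det * Z.trace := by
    intro Z
    rw [← Matrix.mul_assoc, Matrix.adjugate_mul]; simp
  have e3 : ∀ Z : T2 n, (R.adjugate * (Z * R)).trace = R.det * Z.trace := by
    intro Z
    rw [Matrix.trace_mul_comm, Matrix.mul_assoc, Matrix.mul_adjugate]; simp
  have e4 : (n:ℂ) * J (D (c x, c y)) = (n:ℂ) * (R.det * ((tau (deriv (F 1 y) 0) - tau (deriv (F (-1) y) 0)) - (tau (deriv (F 1 x) 0) - tau (deriv (F (-1) x) 0)))) := by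
    rw [← smul_eq_mul, ← map_smul, e1, hJ2, Matrix.mul_sub, Matrix.trace_sub, e2, e3, Matrix.trace_add, Matrix.trace_add,
      l1_trace, l1_trace, l2_trace, l2_trace]
    ring
  exact mul_left_cancel₀ hn0 e4

theorem c2_const (hn : 2 ≤ n) (hA : IsAYBESolution r) (hHolo : IsHolomorphicOnDomain r)
    (hc : Differentiable ℂ c) (hc0 : ∀ y, c y ≠ 0)
    (hF : ∀ u, u ≠ 0 → PD r u 1 (F u) ∧ ∀ y, F u y 0 = c y • Pmat n) (x y : ℂ) : c x = c y := by
  obtain ⟨σ, hσ⟩ := c2_det r c F hn hA hHolo hF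
  have hH : ∀ x y, x ≠ y → ∃ L : ℂ × ℂ →L[ℂ] ℂ,
      HasFDerivAt (fun p : ℂ × ℂ => (r 2 p.1 p.2).det * (r 2 p.2 p.1).det) L (x, y) ∧ L (c x, c y) = 0 := by
    intro x y hxy
    obtain ⟨L1, h1, h1'⟩ := hσ x y hxy
    obtain ⟨L2, h2, h2'⟩ := hσ y x hxy.symm
    have h3 : HasFDerivAt (fun p : ℂ × ℂ => (r 2 p.2 p.1).det)
        (L2.comp ((ContinuousLinearMap.snd ℂ ℂ ℂ).prod (ContinuousLinearMap.fst ℂ ℂ ℂ))) (x, y) :=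
      HasFDerivAt.comp (x, y) (f := fun p : ℂ × ℂ => (p.2, p.1)) (g := fun p : ℂ × ℂ => (r 2 p.1 p.2).det) h2
        ((ContinuousLinearMap.snd ℂ ℂ ℂ).prod (ContinuousLinearMap.fst ℂ ℂ ℂ)).hasFDerivAt
    refine ⟨_, h1.mul h3, ?_⟩
    simp only [_root_.add_apply, _root_.smul_apply, ContinuousLinearMap.comp_apply, ContinuousLinearMap.prod_apply,
      ContinuousLinearMap.coe_snd', ContinuousLinearMap.coe_fst', smul_eq_mul, h1', h2']
    ring
  refine a3_key c hc hc0 (fun p : ℂ × ℂ => (r 2 p.1 p.2).det * (r 2 p.2 p.1).det)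
    (fun x y hxy => ?_) (fun x y hxy => ?_) (Fintype.card (Fin n × Fin n)) ?_ (fun p => ?_) x y
  · obtain ⟨L, h, _⟩ := hH x y hxy
    exact h.differentiableAt
  · obtain ⟨L, h, h'⟩ := hH x y hxy
    rw [h.fderiv, h']
  · simp; omega
  · have hP : (c p • Pmat n).det ≠ 0 := by
      rw [Matrix.det_smul]
      refine mul_ne_zero (pow_ne_zero _ (hc0 p)) fun h => ?_
      have := congrArg Matrix.det (P_sq n)
      rw [Matrix.det_mul, h] at this
      simp at this
    refine ⟨(c p • Pmat n).det * (c p • Pmat n).det, mul_ne_zero hP hP, ?_⟩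
    have hF2 := hF 2 two_ne_zero
    have hcont : Continuous (fun x : ℂ => (F 2 x (p - x)).det * (F 2 p (x - p)).det) := by
      have k1 : Continuous (fun x : ℂ => F 2 x (p - x)) :=
        hF2.1.cont.comp (continuous_id.prodMk (continuous_const.sub continuous_id))
      have k2 : Continuous (fun x : ℂ => F 2 p (x - p)) :=
        hF2.1.cont.comp (continuous_const.prodMk (continuous_id.sub continuous_const))
      exact (Continuous.matrix_det k1).mul (Continuous.matrix_det k2)
    have ht := (hcont.tendsto p).mono_left (nhdsWithin_le_nhds (s := {p}ᶜ))
    simp only [sub_self, hF2.2] at ht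
    refine ht.congr' ?_
    filter_upwards [self_mem_nhdsWithin] with x hx
    have hx' : x ≠ p := hx
    rw [hF2.1.eq x (p - x) (sub_ne_zero.2 hx'.symm), hF2.1.eq p (x - p) (sub_ne_zero.2 hx'),
      Matrix.det_smul, Matrix.det_smul, pow_one, pow_one, mul_pow]
    simp only [add_sub_cancel]
    ring
end

theorem c2_final (n : ℕ) (hn : 2 ≤ n)
    (r : ℂ → ℂ → ℂ → T2 n)
    (hAYBE : IsAYBESolution r) (hUnit : IsUnitarySolution r) (hND : IsNonDegenerate r)
    (hHolo : IsHolomorphicOnDomain r) (hMero : IsMeromorphicAlongDiagonal r)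
    (hPole : ∀ u : ℂ, u ≠ 0 → ∀ y₁ : ℂ,
      Filter.Tendsto (fun y₂ => ‖r u y₁ y₂‖) (𝓝[≠] y₁) Filter.atTop) :
    ∃ c : ℂ, c ≠ 0 ∧ ∀ u : ℂ, u ≠ 0 → ∀ y₁ : ℂ,
      Filter.Tendsto (fun y₂ => (y₁ - y₂) • r u y₁ y₂) (𝓝[≠] y₁) (𝓝 (c • Pmat n)) := by
  obtain ⟨c, F, hc, hc0, hF⟩ := b2_main hn r hAYBE hUnit hND hHolo hMero hPole
  have hconst := c2_const r c F hn hAYBE hHolo hc hc0 hF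
  refine ⟨-c 0, neg_ne_zero.2 (hc0 0), fun u hu y => ?_⟩
  have k : Continuous (fun z : ℂ => -F u y (z - y)) :=
    ((hF u hu).1.cont.comp (continuous_const.prodMk (continuous_id.sub continuous_const))).neg
  have ht := (k.tendsto y).mono_left (nhdsWithin_le_nhds (s := {y}ᶜ))
  simp only [sub_self, (hF u hu).2] at ht
  rw [hconst y 0, ← neg_smul] at ht
  refine ht.congr' ?_
  filter_upwards [self_mem_nhdsWithin] with z hz
  have hz' : z ≠ y := hz
  rw [(hF u hu).1.eq y (z - y) (sub_ne_zero.2 hz'), pow_one, ← neg_smul, neg_sub, add_sub_cancel]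

/-- If a non-degenerate unitary solution of the AYBE (holomorphic on the
domain, meromorphic along the diagonal) has a pole along `y₁ = y₂`, then the pole is simple
and `lim_{y₂→y₁} (y₁−y₂)·r(u;y₁,y₂) = c·P` for a constant `c ≠ 0` independent of `u, y₁`. -/
theorem pole_along_diagonal_is_simple (n : ℕ) (hn : 2 ≤ n)
    (r : ℂ → ℂ → ℂ → T2 n)
    (hAYBE : IsAYBESolution r) (hUnit : IsUnitarySolution r) (hND : IsNonDegenerate r)
    (hHolo : IsHolomorphicOnDomain r) (hMero : IsMeromorphicAlongDiagonal r)
    (hPole : ∀ u : ℂ, u ≠ 0 → ∀ y₁ : ℂ,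
      Filter.Tendsto (fun y₂ => ‖r u y₁ y₂‖) (𝓝[≠] y₁) Filter.atTop) :
    ∃ c : ℂ, c ≠ 0 ∧ ∀ u : ℂ, u ≠ 0 → ∀ y₁ : ℂ,
      Filter.Tendsto (fun y₂ => (y₁ - y₂) • r u y₁ y₂) (𝓝[≠] y₁) (𝓝 (c • Pmat n)) := by
  exact c2_final n hn r hAYBE hUnit hND hHolo hMero hPole
end
end
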